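/- arXiv:2403.03887 — 4 statements merged into one kernel-verified Lean document; each statement's English description precedes it below -/
import Mathlib

section
/- The commutator subgroup of the group Homeo(S¹ × ℝ) of self-homeomorphisms of the open annulus has index 4 in Homeo(S¹ × ℝ), and moreover g² lies in the commutator subgroup for every g ∈ Homeo(S¹ × ℝ) (so the abelianization is elementary abelian of order 4, i.e. isomorphic to ℤ/2ℤ × ℤ/2ℤ). -/
open Pointwise

instance instGroupHomeomorph (X : Type*) [TopologicalSpace X] : Group (X ≃ₜ X) where
  mul f g := g.trans f
  one := Homeomorph.refl X
  inv := Homeomorph.symm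
  mul_assoc _ _ _ := Homeomorph.ext fun _ => rfl
  one_mul _ := Homeomorph.ext fun _ => rfl
  mul_one _ := Homeomorph.ext fun _ => rfl
  inv_mul_cancel f := Homeomorph.ext fun x => f.symm_apply_apply x

open Set Filter Topology

/-- If `f` and `s` agree on `A` and the forward orbits of `s` stay in `A`, then eventual agreement
does not depend on the number of iterations. -/
theorem iterate_eq_of_le {X : Type*} {f s : X → X} {A : Set X} (hfs : EqOn f s A)
    (hs : MapsTo s A A) {x y : X} {n m : ℕ} (hnm : n ≤ m) (hx : s^[n] x ∈ A)
    (hxy : f^[n] y = s^[n] x) : s^[m] x ∈ A ∧ f^[m] y = s^[m] x := by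
  induction m, hnm using Nat.le_induction with
  | base => exact ⟨hx, hxy⟩
  | succ m _ ih =>
    rw [Function.iterate_succ_apply', Function.iterate_succ_apply', ih.2]
    exact ⟨hs ih.1, hfs ih.1⟩

/-- The conjugating map `f⁻ⁿ ∘ sⁿ` of two homeomorphisms which agree on `A`. -/
theorem exists_continuous_conj {X : Type*} [TopologicalSpace X] (f s : X ≃ₜ X) {A : Set X}
    (hA : IsOpen A) (hfs : EqOn f s A) (hs : MapsTo s A A) (hsA : ∀ x, ∃ n : ℕ, s^[n] x ∈ A) :
    ∃ c : X → X, Continuous c ∧ ∀ x, ∃ n : ℕ, s^[n] x ∈ A ∧ f^[n] (c x) = s^[n] x := by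
  choose n hn using hsA
  have hinv : ∀ (k : ℕ) (y : X), f^[k] (f.symm^[k] y) = y := fun k =>
    (Function.RightInverse.iterate (f := f) (g := f.symm) f.apply_symm_apply k)
  refine ⟨fun x => f.symm^[n x] (s^[n x] x), ?_, fun x => ⟨n x, hn x, hinv _ _⟩⟩
  refine continuous_iff_continuousAt.2 fun x => ?_
  have hopen : {y | s^[n x] y ∈ A} ∈ 𝓝 x :=
    (hA.preimage (s.continuous.iterate _)).mem_nhds (hn x)
  have hcont : Continuous fun y => f.symm^[n x] (s^[n x] y) :=
    (f.symm.continuous.iterate _).comp (s.continuous.iterate _)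
  refine hcont.continuousAt.congr ?_
  filter_upwards [hopen] with y hy
  have h1 := iterate_eq_of_le hfs hs (le_max_left (n x) (n y)) hy (hinv (n x) _)
  have h2 := iterate_eq_of_le hfs hs (le_max_right (n x) (n y)) (hn y) (hinv (n y) _)
  exact (f.injective.iterate _) (h1.2.trans h2.2.symm)

/-- Two homeomorphisms which agree on an open set `A` that absorbs all orbits are conjugate. -/
theorem exists_conj_of_eqOn {X : Type*} [TopologicalSpace X] (f s : X ≃ₜ X) {A : Set X}
    (hA : IsOpen A) (hfs : EqOn f s A) (hs : MapsTo s A A) (hsA : ∀ x, ∃ n : ℕ, s^[n] x ∈ A)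
    (hfA : ∀ x, ∃ n : ℕ, f^[n] x ∈ A) :
    ∃ c : X ≃ₜ X, (∀ x, f (c x) = c (s x)) ∧ EqOn c id A := by
  have hf : MapsTo f A A := fun x hx => hfs hx ▸ hs hx
  obtain ⟨c, hc, hcs⟩ := exists_continuous_conj f s hA hfs hs hsA
  obtain ⟨d, hd, hdf⟩ := exists_continuous_conj s f hA hfs.symm hf hfA
  have key : ∀ {x y : X} {n : ℕ}, s^[n] x ∈ A → f^[n] y = s^[n] x → c x = y := by
    intro x y n hx hy
    obtain ⟨m, hm, hm'⟩ := hcs x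
    have h1 := iterate_eq_of_le hfs hs (le_max_left n m) hx hy
    have h2 := iterate_eq_of_le hfs hs (le_max_right n m) hm hm'
    exact (f.injective.iterate _) (h2.2.trans h1.2.symm)
  have key' : ∀ {x y : X} {n : ℕ}, f^[n] x ∈ A → s^[n] y = f^[n] x → d x = y := by
    intro x y n hx hy
    obtain ⟨m, hm, hm'⟩ := hdf x
    have h1 := iterate_eq_of_le hfs.symm hf (le_max_left n m) hx hy
    have h2 := iterate_eq_of_le hfs.symm hf (le_max_right n m) hm hm'
    exact (s.injective.iterate _) (h2.2.trans h1.2.symm)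
  refine ⟨⟨⟨c, d, fun x => ?_, fun x => ?_⟩, hc, hd⟩, fun x => ?_, fun x hx => ?_⟩
  · obtain ⟨n, hn, hn'⟩ := hcs x
    exact key' (hn' ▸ hn) hn'.symm
  · obtain ⟨n, hn, hn'⟩ := hdf x
    exact key (hn' ▸ hn) hn'.symm
  · obtain ⟨n, hn, hn'⟩ := hcs x
    refine (key (n := n) ?_ ?_).symm
    · rw [← Function.iterate_succ_apply, Function.iterate_succ_apply']
      exact hs hn
    · change f^[n] (f (c x)) = _
      rw [← Function.iterate_succ_apply, ← Function.iterate_succ_apply,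
        Function.iterate_succ_apply', Function.iterate_succ_apply', hn']
      exact hfs hn
  · exact key (n := 0) hx rfl

/-- A strictly monotone continuous function with infinite limits is an order isomorphism. -/
theorem exists_orderIso_of_strictMono {f : ℝ → ℝ} (hf : StrictMono f) (hc : Continuous f)
    (ht : Tendsto f atTop atTop) (hb : Tendsto f atBot atBot) : ∃ e : ℝ ≃o ℝ, ∀ x, e x = f x :=
  ⟨hf.orderIsoOfSurjective f (hc.surjective ht hb), fun _ => rfl⟩

/-- A continuous function on the annulus is bounded by a monotone function of the height. -/
theorem exists_monotone_bound {m : Circle × ℝ → ℝ} (hm : Continuous m) :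
    ∃ W : ℝ → ℝ, Continuous W ∧ Monotone W ∧ (∀ t, 0 ≤ W t) ∧
      ∀ (z : Circle) (t s : ℝ), |t| ≤ s → |m (z, t)| ≤ W s := by
  set K : Set (Circle × ℝ) := univ ×ˢ Icc (-1) 1 with hK
  have hKc : IsCompact K := isCompact_univ.prod isCompact_Icc
  set F : ℝ → Circle × ℝ → ℝ := fun T p => |m (p.1, T * p.2)| with hF
  have hFc : Continuous ↿F := by
    simp only [hF, Function.HasUncurry.uncurry, id]
    fun_prop
  set V : ℝ → ℝ := fun T => sSup (F T '' K) with hV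
  have hVc : Continuous V := hKc.continuous_sSup hFc
  have hbdd : ∀ T, BddAbove (F T '' K) := fun T =>
    (hKc.image (hFc.comp (Continuous.prodMk_right T))).bddAbove
  have hle : ∀ (z : Circle) (t s : ℝ), |t| ≤ s → |m (z, t)| ≤ V s := by
    intro z t s hts
    rcases (abs_nonneg t).trans hts |>.eq_or_lt with h0 | h0
    · have : t = 0 := abs_eq_zero.1 (le_antisymm (h0 ▸ hts) (abs_nonneg t))
      refine le_csSup (hbdd s) ⟨(z, 0), ⟨mem_univ _, by simp⟩, by simp [hF, this]⟩
    · refine le_csSup (hbdd s) ⟨(z, t / s), ⟨mem_univ _, ?_⟩, ?_⟩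
      · rw [mem_Icc, ← abs_le, abs_div, abs_of_pos h0]
        exact (div_le_one h0).2 hts
      · simp only [hF]
        rw [mul_div_cancel₀ _ h0.ne']
  refine ⟨fun t => V (max t 0), hVc.comp (by fun_prop), ?_, fun t => ?_, fun z t s hts => ?_⟩
  · intro a b hab
    refine csSup_le (⟨_, ⟨(1, 0), ⟨mem_univ _, by simp⟩, rfl⟩⟩) ?_
    rintro _ ⟨⟨z, r⟩, ⟨-, hr⟩, rfl⟩
    refine hle _ _ _ ?_
    have hr' : |r| ≤ 1 := abs_le.2 hr
    rw [abs_mul, abs_of_nonneg (le_max_right a 0)]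
    calc max a 0 * |r| ≤ max a 0 * 1 := by gcongr
      _ ≤ max b 0 := by rw [mul_one]; exact max_le_max_right 0 hab
  · exact (abs_nonneg _).trans (hle 1 0 _ (by simp))
  · beta_reduce
    rw [max_eq_left ((abs_nonneg t).trans hts)]
    exact hle z t s hts

/-- The homeomorphism of the annulus acting on the second factor only. -/
noncomputable def heightHomeo (e : ℝ ≃ₜ ℝ) : (Circle × ℝ) ≃ₜ (Circle × ℝ) :=
  (Homeomorph.refl Circle).prodCongr e

theorem heightHomeo_apply (e : ℝ ≃ₜ ℝ) (p : Circle × ℝ) : heightHomeo e p = (p.1, e p.2) := rfl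

theorem exists_iterate_lt {X : Type*} {g : X → X} {η : X → ℝ} (hg : ∀ x, η (g x) ≤ η x - 1)
    (a : ℝ) (x : X) : ∃ n : ℕ, η (g^[n] x) < a := by
  have h : ∀ n : ℕ, η (g^[n] x) ≤ η x - n := by
    intro n
    induction n with
    | zero => simp
    | succ n ih =>
      rw [Function.iterate_succ_apply']
      push_cast
      linarith [hg (g^[n] x)]
  obtain ⟨n, hn⟩ := exists_nat_gt (η x - a)
  exact ⟨n, by linarith [h n]⟩

/-- A homeomorphism which is the identity near the lower end is a commutator. -/
theorem mem_commutator_of_eq_id_below {f : (Circle × ℝ) ≃ₜ (Circle × ℝ)} {a : ℝ}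
    (hf : ∀ p : Circle × ℝ, p.2 ≤ a → f p = p) : f ∈ commutator ((Circle × ℝ) ≃ₜ (Circle × ℝ)) := by
  have hf' : ∀ p : Circle × ℝ, p.2 ≤ a → f.symm p = p := fun p hp =>
    (Homeomorph.symm_apply_eq f).2 (hf p hp).symm
  obtain ⟨W, hWc, hWm, hW0, hW⟩ := exists_monotone_bound
    (m := fun p : Circle × ℝ => (f.symm (p.1, a + p.2)).2 - (a + p.2)) (by fun_prop)
  obtain ⟨ψ, hψ⟩ := exists_orderIso_of_strictMono (f := fun t => t + 1 + W (t + 1 - a))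
    (fun x y hxy => by
      have := hWm (show x + 1 - a ≤ y + 1 - a by linarith)
      change x + 1 + W (x + 1 - a) < y + 1 + W (y + 1 - a)
      linarith) (by fun_prop)
    (tendsto_atTop_mono (fun t => by have := hW0 (t + 1 - a); simp only [id]; linarith) tendsto_id)
    (by
      refine tendsto_atBot_mono' atBot ?_
        (tendsto_atBot_add_const_right atBot (1 + W 0) tendsto_id)
      filter_upwards [eventually_le_atBot (a - 1)] with t ht
      have := hWm (show t + 1 - a ≤ 0 by linarith)
      simp only [id]
      linarith)
  have hψle : ∀ t, t + 1 ≤ ψ t := fun t => by rw [hψ]; linarith [hW0 (t + 1 - a)]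
  set s := heightHomeo ψ.toHomeomorph with hs
  have hss : ∀ p : Circle × ℝ, s.symm p = (p.1, ψ.symm p.2) := fun p => rfl
  have hψs : ∀ t, ψ.symm t ≤ t - 1 := fun t => by
    rw [ψ.symm_apply_le]
    linarith [hψle (t - 1)]
  set F : (Circle × ℝ) ≃ₜ (Circle × ℝ) := f.symm.trans s.symm with hF
  have hFd : ∀ p, (F p).2 ≤ p.2 - 1 := by
    intro p
    change ψ.symm (f.symm p).2 ≤ _
    rw [ψ.symm_apply_le, hψ]
    rcases le_total p.2 a with hp | hp
    · rw [hf' p hp]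
      linarith [hW0 (p.2 - 1 + 1 - a)]
    · have := hW p.1 (p.2 - a) (p.2 - 1 + 1 - a) (by rw [abs_of_nonneg (by linarith)]; linarith)
      have h2 := (le_abs_self _).trans this
      rw [add_sub_cancel] at h2
      linarith
  obtain ⟨c, hc, -⟩ := exists_conj_of_eqOn F s.symm (A := {p : Circle × ℝ | p.2 < a})
    (isOpen_lt continuous_snd continuous_const)
    (fun p hp => by
      change s.symm (f.symm p) = s.symm p
      rw [hf' p (le_of_lt hp)])
    (fun p hp => by
      change ψ.symm p.2 < a
      linarith [hψs p.2, show p.2 < a from hp])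
    (exists_iterate_lt (fun p => hψs p.2) a) (exists_iterate_lt hFd a)
  have hcs : s⁻¹ * f⁻¹ * c = c * s⁻¹ := Homeomorph.ext hc
  have : f = c * s * c⁻¹ * s⁻¹ := by
    rw [← inv_inj, ← mul_right_inj s⁻¹, ← mul_left_inj c, hcs]
    group
  rw [this, ← commutatorElement_def]
  exact Subgroup.commutator_mem_commutator (Subgroup.mem_top _) (Subgroup.mem_top _)

theorem commutator_conj_mem_iff {G : Type*} [Group G] {f : G} (g : G) :
    g * f * g⁻¹ ∈ commutator G ↔ f ∈ commutator G := by
  refine ⟨fun h => ?_, fun h => (inferInstance : (commutator G).Normal).conj_mem f h g⟩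
  have := (inferInstance : (commutator G).Normal).conj_mem _ h g⁻¹
  rwa [show g⁻¹ * (g * f * g⁻¹) * g⁻¹⁻¹ = f by group] at this

/-- The reflection of the annulus exchanging the ends. -/
noncomputable def heightNeg : (Circle × ℝ) ≃ₜ (Circle × ℝ) := heightHomeo (Homeomorph.neg ℝ)

theorem heightNeg_apply (p : Circle × ℝ) : heightNeg p = (p.1, -p.2) := rfl

theorem heightNeg_symm_apply (p : Circle × ℝ) : heightNeg.symm p = (p.1, -p.2) := rfl

/-- A homeomorphism which is the identity near the upper end is a commutator. -/
theorem mem_commutator_of_eq_id_above {f : (Circle × ℝ) ≃ₜ (Circle × ℝ)} {a : ℝ}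
    (hf : ∀ p : Circle × ℝ, a ≤ p.2 → f p = p) : f ∈ commutator ((Circle × ℝ) ≃ₜ (Circle × ℝ)) := by
  rw [← commutator_conj_mem_iff heightNeg]
  refine mem_commutator_of_eq_id_below (a := -a) fun p hp => ?_
  change heightNeg (f (heightNeg.symm p)) = p
  rw [hf _ (by rw [heightNeg_symm_apply]; linarith), Homeomorph.apply_symm_apply]

/-- Neighbourhoods of the upper end of the annulus. -/
def upperEnd : Filter (Circle × ℝ) := comap Prod.snd atTop

/-- Neighbourhoods of the lower end of the annulus. -/
def lowerEnd : Filter (Circle × ℝ) := comap Prod.snd atBot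

/-- `h` fixes both ends of the annulus. -/
def FixesEnds (h : (Circle × ℝ) ≃ₜ (Circle × ℝ)) : Prop :=
  Tendsto h upperEnd upperEnd ∧ Tendsto h lowerEnd lowerEnd

/-- `h` exchanges the ends of the annulus. -/
def SwapsEnds (h : (Circle × ℝ) ≃ₜ (Circle × ℝ)) : Prop :=
  Tendsto h upperEnd lowerEnd ∧ Tendsto h lowerEnd upperEnd

theorem cocompact_annulus : cocompact (Circle × ℝ) = lowerEnd ⊔ upperEnd := by
  rw [← Filter.coprod_cocompact, Filter.coprod, cocompact_eq_bot, comap_bot, bot_sup_eq,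
    cocompact_eq_atBot_atTop, comap_sup, lowerEnd, upperEnd]

instance : NeBot upperEnd := by
  rw [upperEnd]; exact (inferInstance : NeBot (atTop : Filter ℝ)).comap_of_surj Prod.snd_surjective

theorem disjoint_ends : Disjoint upperEnd lowerEnd :=
  disjoint_comap disjoint_atTop_atBot

theorem tendsto_heightNeg_upperEnd : Tendsto heightNeg upperEnd lowerEnd :=
  tendsto_comap_iff.2 (tendsto_neg_atTop_atBot.comp tendsto_comap)

theorem tendsto_heightNeg_lowerEnd : Tendsto heightNeg lowerEnd upperEnd :=
  tendsto_comap_iff.2 (tendsto_neg_atBot_atTop.comp tendsto_comap)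

theorem FixesEnds.not_swapsEnds {h : (Circle × ℝ) ≃ₜ (Circle × ℝ)} (hf : FixesEnds h) :
    ¬ SwapsEnds h := fun hs =>
  (hf.1.not_tendsto disjoint_ends) hs.1

theorem tendsto_upperEnd_dichotomy {h : Circle × ℝ → Circle × ℝ} (hc : Continuous h)
    (ht : Tendsto h upperEnd (lowerEnd ⊔ upperEnd)) :
    Tendsto h upperEnd lowerEnd ∨ Tendsto h upperEnd upperEnd := by
  have hne : ∀ᶠ p in upperEnd, (h p).2 ≠ 0 := by
    refine ht.eventually (p := fun q => q.2 ≠ 0) (eventually_sup.2 ⟨?_, ?_⟩)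
    · exact tendsto_comap.eventually (eventually_ne_atBot 0)
    · exact tendsto_comap.eventually (eventually_ne_atTop 0)
  obtain ⟨s, hs, hsub⟩ := mem_comap.1 hne
  obtain ⟨T, hT⟩ := mem_atTop_sets.1 hs
  set S : Set (Circle × ℝ) := univ ×ˢ Ici T with hS
  have hSc : IsPreconnected S := isPreconnected_univ.prod isPreconnected_Ici
  have hSm : S ∈ upperEnd := by
    refine mem_comap.2 ⟨Ici T, Ici_mem_atTop T, fun p hp => ⟨mem_univ _, hp⟩⟩
  have hS0 : ∀ p ∈ S, (h p).2 ≠ 0 := fun p hp => hsub (hT _ hp.2)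
  have himg : IsPreconnected ((fun p => (h p).2) '' S) :=
    hSc.image _ (by fun_prop)
  have hsign : (∀ p ∈ S, (h p).2 < 0) ∨ ∀ p ∈ S, 0 < (h p).2 := by
    by_contra! hcon
    obtain ⟨⟨p, hp, hp'⟩, ⟨q, hq, hq'⟩⟩ := hcon
    obtain ⟨r, hr, hr'⟩ := himg.Icc_subset (mem_image_of_mem _ hq) (mem_image_of_mem _ hp)
      ⟨hq', hp'⟩
    exact hS0 r hr hr'
  rcases hsign with hneg | hpos
  · left
    refine fun u hu => ?_
    have h1 : u ∪ {p | 0 ≤ p.2} ∈ lowerEnd ⊔ upperEnd :=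
      mem_sup.2 ⟨mem_of_superset hu subset_union_left,
        mem_of_superset (preimage_mem_comap (Ici_mem_atTop 0)) subset_union_right⟩
    rw [mem_map]
    filter_upwards [mem_map.1 (ht h1), hSm] with p hp hpS
    exact hp.resolve_right fun hp' => absurd (hneg p hpS) (not_lt.2 hp')
  · right
    refine fun u hu => ?_
    have h1 : u ∪ {p | p.2 ≤ 0} ∈ lowerEnd ⊔ upperEnd :=
      mem_sup.2 ⟨mem_of_superset (preimage_mem_comap (Iic_mem_atBot 0)) subset_union_right,
        mem_of_superset hu subset_union_left⟩
    rw [mem_map]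
    filter_upwards [mem_map.1 (ht h1), hSm] with p hp hpS
    exact hp.resolve_right fun hp' => absurd (hpos p hpS) (not_lt.2 hp')

theorem not_tendsto_upperEnd_of_surjective {h : Circle × ℝ → Circle × ℝ} (hc : Continuous h)
    (hs : Function.Surjective h) : ¬ Tendsto h (cocompact _) upperEnd := by
  intro ht
  obtain ⟨x, hx⟩ := (continuous_snd.comp hc).exists_forall_le (tendsto_comap.comp ht)
  obtain ⟨y, hy⟩ := hs (1, (h x).2 - 1)
  have := hx y
  simp only [Function.comp, hy] at this
  linarith

/-- A homeomorphism of the annulus either fixes or exchanges the two ends. -/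
theorem fixesEnds_or_swapsEnds (h : (Circle × ℝ) ≃ₜ (Circle × ℝ)) : FixesEnds h ∨ SwapsEnds h := by
  have ht : Tendsto h (lowerEnd ⊔ upperEnd) (lowerEnd ⊔ upperEnd) := by
    rw [← cocompact_annulus]; exact h.isClosedEmbedding.tendsto_cocompact
  have h1 := tendsto_upperEnd_dichotomy h.continuous (ht.mono_left le_sup_right)
  have h2 : Tendsto h lowerEnd lowerEnd ∨ Tendsto h lowerEnd upperEnd := by
    have h3 := tendsto_upperEnd_dichotomy (h := h ∘ heightNeg)
      (h.continuous.comp heightNeg.continuous)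
      ((ht.mono_left le_sup_left).comp tendsto_heightNeg_upperEnd)
    have h4 : (h ∘ heightNeg) ∘ heightNeg = h := by
      ext1 p
      simp [heightNeg_apply]
    rcases h3 with h3 | h3
    · exact .inl (h4 ▸ h3.comp tendsto_heightNeg_lowerEnd)
    · exact .inr (h4 ▸ h3.comp tendsto_heightNeg_lowerEnd)
  rcases h1 with h1 | h1 <;> rcases h2 with h2 | h2
  · exfalso
    refine not_tendsto_upperEnd_of_surjective (heightNeg.continuous.comp h.continuous)
      (heightNeg.surjective.comp h.surjective) ?_
    rw [cocompact_annulus]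
    exact tendsto_heightNeg_lowerEnd.comp (h2.sup h1 |>.mono_right (by simp))
  · exact .inr ⟨h1, h2⟩
  · exact .inl ⟨h1, h2⟩
  · exfalso
    refine not_tendsto_upperEnd_of_surjective h.continuous h.surjective ?_
    rw [cocompact_annulus]
    exact (h2.sup h1).mono_right (by simp)

theorem FixesEnds.mul {f g : (Circle × ℝ) ≃ₜ (Circle × ℝ)} (hf : FixesEnds f) (hg : FixesEnds g) :
    FixesEnds (f * g) := ⟨hf.1.comp hg.1, hf.2.comp hg.2⟩

theorem SwapsEnds.mul {f g : (Circle × ℝ) ≃ₜ (Circle × ℝ)} (hf : SwapsEnds f) (hg : SwapsEnds g) :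
    FixesEnds (f * g) := ⟨hf.2.comp hg.1, hf.1.comp hg.2⟩

theorem FixesEnds.mul_swapsEnds {f g : (Circle × ℝ) ≃ₜ (Circle × ℝ)} (hf : FixesEnds f)
    (hg : SwapsEnds g) : SwapsEnds (f * g) := ⟨hf.2.comp hg.1, hf.1.comp hg.2⟩

theorem SwapsEnds.mul_fixesEnds {f g : (Circle × ℝ) ≃ₜ (Circle × ℝ)} (hf : SwapsEnds f)
    (hg : FixesEnds g) : SwapsEnds (f * g) := ⟨hf.1.comp hg.1, hf.2.comp hg.2⟩

theorem fixesEnds_one : FixesEnds (1 : (Circle × ℝ) ≃ₜ (Circle × ℝ)) := ⟨tendsto_id, tendsto_id⟩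

theorem FixesEnds.inv {f : (Circle × ℝ) ≃ₜ (Circle × ℝ)} (hf : FixesEnds f) : FixesEnds f⁻¹ := by
  refine (fixesEnds_or_swapsEnds _).resolve_right fun h => ?_
  have := hf.mul_swapsEnds h
  rw [mul_inv_cancel] at this
  exact fixesEnds_one.not_swapsEnds this

theorem min_pos_of_norm_lt {E : Type*} [NormedAddCommGroup E] {y : E} (hy : ‖y‖ < 2) :
    0 < min 1 (2 - ‖y‖) :=
  lt_min one_pos (by linarith)

section Connell

variable {E : Type*} [NormedAddCommGroup E] [NormedSpace ℝ E]

/-- The radial homeomorphism from `E` to the open ball of radius `2`, fixing the unit ball. -/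
noncomputable def radialShrink (p : E) : E := (max 1 ((1 + ‖p‖) / 2))⁻¹ • p

/-- The inverse of `radialShrink`. -/
noncomputable def radialExpand (y : E) : E := (min 1 (2 - ‖y‖))⁻¹ • y

theorem continuous_radialShrink : Continuous (radialShrink : E → E) := by
  unfold radialShrink
  refine Continuous.smul (Continuous.inv₀ (by fun_prop) fun p => ?_) continuous_id
  exact (lt_of_lt_of_le one_pos (le_max_left _ _)).ne'

theorem continuousOn_radialExpand : ContinuousOn (radialExpand : E → E) {y | ‖y‖ < 2} := by
  unfold radialExpand
  refine ContinuousOn.smul (ContinuousOn.inv₀ (by fun_prop) fun p hp => ?_) continuousOn_id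
  exact (min_pos_of_norm_lt hp).ne'

theorem radialShrink_of_norm_le {p : E} (hp : ‖p‖ ≤ 1) : radialShrink p = p := by
  rw [radialShrink, max_eq_left (by linarith), inv_one, one_smul]

theorem radialExpand_of_norm_le {p : E} (hp : ‖p‖ ≤ 1) : radialExpand p = p := by
  rw [radialExpand, min_eq_left (by linarith), inv_one, one_smul]

theorem norm_radialExpand {y : E} (hy : ‖y‖ < 2) : ‖radialExpand y‖ = ‖y‖ / min 1 (2 - ‖y‖) := by
  rw [radialExpand, norm_smul, norm_inv, Real.norm_of_nonneg (min_pos_of_norm_lt hy).le,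
    inv_mul_eq_div]

theorem max_radialExpand {y : E} (hy : ‖y‖ < 2) :
    max 1 ((1 + ‖radialExpand y‖) / 2) = (min 1 (2 - ‖y‖))⁻¹ := by
  rw [norm_radialExpand hy]
  rcases le_total ‖y‖ 1 with h | h
  · rw [min_eq_left (by linarith), max_eq_left (by linarith), inv_one]
  · rw [min_eq_right (by linarith)]
    have h2 : 0 < 2 - ‖y‖ := by linarith
    have h3 : (1 + ‖y‖ / (2 - ‖y‖)) / 2 = (2 - ‖y‖)⁻¹ := by field_simp; ring
    rw [h3, max_eq_right]
    exact (one_le_inv₀ h2).2 (by linarith)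

theorem radialShrink_radialExpand {y : E} (hy : ‖y‖ < 2) : radialShrink (radialExpand y) = y := by
  rw [radialShrink, max_radialExpand hy, radialExpand, inv_inv,
    smul_inv_smul₀ (min_pos_of_norm_lt hy).ne']

theorem norm_radialShrink (p : E) : ‖radialShrink p‖ = ‖p‖ / max 1 ((1 + ‖p‖) / 2) := by
  rw [radialShrink, norm_smul, norm_inv, Real.norm_of_nonneg (by positivity), inv_mul_eq_div]

theorem norm_radialShrink_lt (p : E) : ‖radialShrink p‖ < 2 := by
  rw [norm_radialShrink, div_lt_iff₀ (by positivity)]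
  have := le_max_right 1 ((1 + ‖p‖) / 2)
  linarith

theorem radialExpand_radialShrink (p : E) : radialExpand (radialShrink p) = p := by
  have : min 1 (2 - ‖radialShrink p‖) = (max 1 ((1 + ‖p‖) / 2))⁻¹ := by
    rw [norm_radialShrink]
    rcases le_total ‖p‖ 1 with h | h
    · rw [max_eq_left (by linarith), min_eq_left (by linarith), inv_one]
    · rw [max_eq_right (by linarith)]
      have h3 : 2 - ‖p‖ / ((1 + ‖p‖) / 2) = ((1 + ‖p‖) / 2)⁻¹ := by
        have : 1 + ‖p‖ ≠ 0 := by positivity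
        field_simp; ring
      rw [h3, min_eq_right]
      exact inv_le_one_of_one_le₀ (by linarith)
  rw [radialExpand, this, inv_inv, radialShrink, smul_inv_smul₀ (by positivity)]

theorem norm_radialShrink_sub_le (p q : E) :
    ‖radialShrink q - radialShrink p‖ ≤ 2 * ‖q - p‖ * (max 1 ((1 + ‖p‖) / 2))⁻¹ := by
  set a := max 1 ((1 + ‖p‖) / 2) with ha
  set b := max 1 ((1 + ‖q‖) / 2) with hb
  have ha0 : 0 < a := by positivity
  have hb0 : 0 < b := by positivity
  have hab : |a - b| ≤ ‖q - p‖ / 2 := by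
    rw [ha, hb, max_comm 1, max_comm 1]
    refine (abs_max_sub_max_le_abs _ _ _).trans ?_
    rw [show (1 + ‖p‖) / 2 - (1 + ‖q‖) / 2 = (‖p‖ - ‖q‖) / 2 by ring, abs_div, abs_two]
    have := abs_norm_sub_norm_le p q
    rw [norm_sub_rev] at this
    linarith
  have hq : ‖q‖ ≤ 2 * b := by
    have := le_max_right 1 ((1 + ‖q‖) / 2)
    linarith
  have hdecomp : radialShrink q - radialShrink p = a⁻¹ • (q - p) + (b⁻¹ - a⁻¹) • q := by
    simp only [radialShrink, ← ha, ← hb]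
    module
  have h2 : |b⁻¹ - a⁻¹| * ‖q‖ ≤ ‖q - p‖ * a⁻¹ := by
    rw [inv_sub_inv hb0.ne' ha0.ne', abs_div, abs_of_pos (mul_pos hb0 ha0), ← div_eq_mul_inv,
      div_mul_eq_mul_div, div_le_div_iff₀ (mul_pos hb0 ha0) ha0]
    have : |a - b| * ‖q‖ ≤ ‖q - p‖ / 2 * (2 * b) := by gcongr
    nlinarith
  calc ‖radialShrink q - radialShrink p‖ ≤ ‖a⁻¹ • (q - p)‖ + ‖(b⁻¹ - a⁻¹) • q‖ := by
        rw [hdecomp]; exact norm_add_le _ _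
    _ = ‖q - p‖ * a⁻¹ + |b⁻¹ - a⁻¹| * ‖q‖ := by
        rw [norm_smul, norm_smul, norm_inv, Real.norm_of_nonneg ha0.le, Real.norm_eq_abs, mul_comm]
    _ ≤ _ := by linarith

/-- The conjugate of `H` by `radialShrink`, extended by the identity. -/
noncomputable def radialConj (H : E → E) (y : E) : E :=
  open Classical in if ‖y‖ < 2 then radialShrink (H (radialExpand y)) else y

theorem radialConj_of_lt (H : E → E) {y : E} (hy : ‖y‖ < 2) :
    radialConj H y = radialShrink (H (radialExpand y)) := if_pos hy

theorem radialConj_of_le (H : E → E) {y : E} (hy : 2 ≤ ‖y‖) : radialConj H y = y :=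
  if_neg hy.not_gt

theorem norm_radialConj_sub_le {H : E → E} {C : ℝ} (hC : ∀ p, ‖H p - p‖ ≤ C * (1 + √‖p‖)) (y : E) :
    ‖radialConj H y - y‖ ≤
      2 * C * (max 0 (min 1 (2 - ‖y‖)) + √(2 * max 0 (min 1 (2 - ‖y‖)))) := by
  have hC0 : 0 ≤ C := by
    have := (norm_nonneg _).trans (hC 0)
    simpa using this
  rcases lt_or_ge ‖y‖ 2 with hy | hy
  · have hm := min_pos_of_norm_lt hy
    rw [radialConj_of_lt H hy, max_eq_right hm.le]
    nth_rewrite 2 [← radialShrink_radialExpand hy]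
    refine (norm_radialShrink_sub_le _ _).trans ?_
    rw [max_radialExpand hy, inv_inv]
    have h1 := hC (radialExpand y)
    rw [norm_radialExpand hy] at h1
    set m := min 1 (2 - ‖y‖)
    have h2 : m * √(‖y‖ / m) ≤ √(2 * m) := by
      refine Real.le_sqrt_of_sq_le ?_
      rw [mul_pow, Real.sq_sqrt (by positivity), pow_two, mul_assoc, mul_div_cancel₀ _ hm.ne']
      nlinarith
    calc _ ≤ 2 * (C * (1 + √(‖y‖ / m))) * m := by gcongr
      _ = 2 * C * (m + m * √(‖y‖ / m)) := by ring
      _ ≤ _ := by gcongr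
  · rw [radialConj_of_le H hy, sub_self, norm_zero]
    positivity

theorem continuous_radialConj {H : E → E} (hH : Continuous H) {C : ℝ}
    (hC : ∀ p, ‖H p - p‖ ≤ C * (1 + √‖p‖)) : Continuous (radialConj H) := by
  refine continuous_iff_continuousAt.2 fun y => ?_
  rcases lt_or_ge ‖y‖ 2 with hy | hy
  · have hopen : IsOpen {y : E | ‖y‖ < 2} := isOpen_lt continuous_norm continuous_const
    refine ContinuousAt.congr (f := fun z => radialShrink (H (radialExpand z))) ?_ ?_
    swap
    · filter_upwards [hopen.mem_nhds hy] with z hz using (radialConj_of_lt H hz).symm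
    exact continuous_radialShrink.continuousAt.comp (hH.continuousAt.comp
      (continuousOn_radialExpand.continuousAt (hopen.mem_nhds hy)))
  · have hlim : Tendsto (fun z => radialConj H z - z) (𝓝 y) (𝓝 0) := by
      refine squeeze_zero_norm (norm_radialConj_sub_le hC) ?_
      have hcont : Continuous fun z : E =>
          2 * C * (max 0 (min 1 (2 - ‖z‖)) + √(2 * max 0 (min 1 (2 - ‖z‖)))) := by fun_prop
      have h0 : max 0 (min 1 (2 - ‖y‖)) = 0 :=
        max_eq_left ((min_le_right _ _).trans (by linarith))
      have := hcont.tendsto y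
      simpa [h0] using this
    have := hlim.add (tendsto_id (x := 𝓝 y))
    simp only [id, sub_add_cancel, zero_add] at this
    rw [ContinuousAt, radialConj_of_le H hy]
    exact this

theorem radialConj_leftInverse {H G : E → E} (h : Function.LeftInverse G H) :
    Function.LeftInverse (radialConj G) (radialConj H) := by
  intro y
  rcases lt_or_ge ‖y‖ 2 with hy | hy
  · rw [radialConj_of_lt H hy, radialConj_of_lt G (norm_radialShrink_lt _),
      radialExpand_radialShrink, h, radialShrink_radialExpand hy]
  · rw [radialConj_of_le H hy, radialConj_of_le G hy]

/-- A homeomorphism fixing the origin whose displacement grows slowly has the same germ at the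
origin as a compactly supported one. -/
theorem exists_homeo_eq_near_zero (H : E ≃ₜ E) (h0 : H 0 = 0) {C : ℝ}
    (hC : ∀ p, ‖H p - p‖ ≤ C * (1 + √‖p‖)) (hC' : ∀ p, ‖H.symm p - p‖ ≤ C * (1 + √‖p‖)) :
    ∃ K : E ≃ₜ E, (∀ᶠ p in 𝓝 0, K p = H p) ∧ ∀ p, 2 ≤ ‖p‖ → K p = p := by
  refine ⟨⟨⟨radialConj H, radialConj H.symm, radialConj_leftInverse H.symm_apply_apply,
    radialConj_leftInverse H.apply_symm_apply⟩, continuous_radialConj H.continuous hC,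
    continuous_radialConj H.symm.continuous hC'⟩, ?_, fun p hp => radialConj_of_le H hp⟩
  have h1 : ∀ᶠ p : E in 𝓝 0, ‖p‖ < 1 :=
    continuous_norm.continuousAt.eventually_lt continuousAt_const (by simp)
  have h2 : ∀ᶠ p : E in 𝓝 0, ‖H p‖ < 1 :=
    (continuous_norm.comp H.continuous).continuousAt.eventually_lt continuousAt_const (by simp [h0])
  filter_upwards [h1, h2] with p hp hp'
  change radialConj H p = H p
  rw [radialConj_of_lt H (by linarith), radialExpand_of_norm_le hp.le,
    radialShrink_of_norm_le hp'.le]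

end Connell

/-- The identification of the annulus with the punctured plane. -/
noncomputable def toPlane (p : Circle × ℝ) : ℂ := (Real.exp p.2 : ℂ) * p.1

/-- The inverse of `toPlane`, with a junk value at the origin. -/
noncomputable def ofPlane (w : ℂ) : Circle × ℝ := (Circle.exp w.arg, Real.log ‖w‖)

theorem continuous_toPlane : Continuous toPlane := by
  unfold toPlane
  fun_prop

theorem norm_toPlane (p : Circle × ℝ) : ‖toPlane p‖ = Real.exp p.2 := by
  rw [toPlane, norm_mul, Circle.norm_coe, mul_one, Complex.norm_real, Real.norm_of_nonneg]
  positivity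

theorem toPlane_ne_zero (p : Circle × ℝ) : toPlane p ≠ 0 := by
  rw [← norm_ne_zero_iff, norm_toPlane]
  positivity

theorem coe_ofPlane_fst {w : ℂ} (hw : w ≠ 0) : ((ofPlane w).1 : ℂ) = w / ‖w‖ := by
  have h : (‖w‖ : ℂ) ≠ 0 := by exact_mod_cast norm_ne_zero_iff.2 hw
  rw [ofPlane, Circle.coe_exp, eq_div_iff h, mul_comm, Complex.norm_mul_exp_arg_mul_I]

theorem toPlane_ofPlane {w : ℂ} (hw : w ≠ 0) : toPlane (ofPlane w) = w := by
  have h : ‖w‖ ≠ 0 := norm_ne_zero_iff.2 hw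
  rw [toPlane, coe_ofPlane_fst hw, ofPlane, Real.exp_log (norm_pos_iff.2 hw)]
  have : (‖w‖ : ℂ) ≠ 0 := by exact_mod_cast h
  field_simp

theorem ofPlane_toPlane (p : Circle × ℝ) : ofPlane (toPlane p) = p := by
  refine Prod.ext (Circle.ext ?_) ?_
  · rw [coe_ofPlane_fst (toPlane_ne_zero p), norm_toPlane, toPlane]
    have : (Real.exp p.2 : ℂ) ≠ 0 := by exact_mod_cast (Real.exp_pos p.2).ne'
    field_simp
  · rw [ofPlane, norm_toPlane, Real.log_exp]

theorem continuousAt_ofPlane {w : ℂ} (hw : w ≠ 0) : ContinuousAt ofPlane w := by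
  refine ContinuousAt.prodMk ?_ ?_
  · refine (IsInducing.subtypeVal (t := {w : ℂ | w ∈ Submonoid.unitSphere ℂ})).continuousAt_iff.2 ?_
    have h1 : ContinuousAt (fun w : ℂ => w / ‖w‖) w :=
      continuousAt_id.div (by fun_prop) (by simpa using hw)
    refine h1.congr ?_
    filter_upwards [isOpen_ne.mem_nhds hw] with v hv using (coe_ofPlane_fst hv).symm
  · exact continuous_norm.continuousAt.log (norm_ne_zero_iff.2 hw)

theorem tendsto_ofPlane : Tendsto ofPlane (𝓝[≠] 0) lowerEnd :=
  tendsto_comap_iff.2 (Real.tendsto_log_nhdsNE_zero.comp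
    (tendsto_nhdsWithin_iff.2 ⟨tendsto_norm_zero.mono_left nhdsWithin_le_nhds,
      eventually_mem_of_tendsto_nhdsWithin (tendsto_id (α := ℂ)) |>.mono fun _ hw =>
        norm_ne_zero_iff.2 hw⟩))

theorem tendsto_toPlane : Tendsto toPlane lowerEnd (𝓝 0) := by
  rw [tendsto_zero_iff_norm_tendsto_zero]
  simp only [norm_toPlane]
  exact Real.tendsto_exp_atBot.comp tendsto_comap

/-- The extension over the origin of a self-map of the punctured plane. -/
noncomputable def planeExtend (h : Circle × ℝ → Circle × ℝ) : ℂ → ℂ :=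
  open Classical in Function.update (fun w => toPlane (h (ofPlane w))) 0 0

theorem planeExtend_zero (h : Circle × ℝ → Circle × ℝ) : planeExtend h 0 = 0 :=
  Function.update_self ..

theorem planeExtend_of_ne (h : Circle × ℝ → Circle × ℝ) {w : ℂ} (hw : w ≠ 0) :
    planeExtend h w = toPlane (h (ofPlane w)) := Function.update_of_ne hw ..

theorem continuous_planeExtend {h : Circle × ℝ → Circle × ℝ} (hc : Continuous h)
    (hb : Tendsto h lowerEnd lowerEnd) : Continuous (planeExtend h) := by
  refine continuous_iff_continuousAt.2 fun w => ?_
  rcases eq_or_ne w 0 with rfl | hw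
  · exact continuousAt_update_same.2 (tendsto_toPlane.comp (hb.comp tendsto_ofPlane))
  · refine ContinuousAt.congr (f := fun w => toPlane (h (ofPlane w))) ?_ ?_
    · exact continuous_toPlane.continuousAt.comp (hc.continuousAt.comp (continuousAt_ofPlane hw))
    · filter_upwards [isOpen_ne.mem_nhds hw] with v hv using (planeExtend_of_ne h hv).symm

theorem planeExtend_leftInverse {g h : Circle × ℝ → Circle × ℝ} (hgh : Function.LeftInverse g h) :
    Function.LeftInverse (planeExtend g) (planeExtend h) := by
  intro w
  rcases eq_or_ne w 0 with rfl | hw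
  · rw [planeExtend_zero, planeExtend_zero]
  · rw [planeExtend_of_ne h hw, planeExtend_of_ne g (toPlane_ne_zero _), ofPlane_toPlane, hgh,
      toPlane_ofPlane hw]

/-- A homeomorphism of the annulus fixing the ends extends to the plane. -/
theorem FixesEnds.exists_plane {h : (Circle × ℝ) ≃ₜ (Circle × ℝ)} (hh : FixesEnds h) :
    ∃ k : ℂ ≃ₜ ℂ, k 0 = 0 ∧ ∀ p, k (toPlane p) = toPlane (h p) :=
  ⟨⟨⟨planeExtend h, planeExtend h.symm, planeExtend_leftInverse h.symm_apply_apply,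
    planeExtend_leftInverse h.apply_symm_apply⟩, continuous_planeExtend h.continuous hh.2,
    continuous_planeExtend h.symm.continuous hh.inv.2⟩, planeExtend_zero _, fun p => by
      change planeExtend h (toPlane p) = _
      rw [planeExtend_of_ne _ (toPlane_ne_zero p), ofPlane_toPlane]⟩

/-- A homeomorphism of the plane fixing the origin restricts to the annulus. -/
theorem exists_of_plane {k : ℂ ≃ₜ ℂ} (hk : k 0 = 0) :
    ∃ h : (Circle × ℝ) ≃ₜ (Circle × ℝ), ∀ p, toPlane (h p) = k (toPlane p) := by
  have key : ∀ (k : ℂ ≃ₜ ℂ), k 0 = 0 → (∀ w, w ≠ 0 → k w ≠ 0) ∧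
      Continuous fun p => ofPlane (k (toPlane p)) := by
    intro k hk
    have hne : ∀ w, w ≠ 0 → k w ≠ 0 := fun w hw h => hw (k.injective (h.trans hk.symm))
    refine ⟨hne, continuous_iff_continuousAt.2 fun p => ?_⟩
    exact (continuousAt_ofPlane (hne _ (toPlane_ne_zero p))).comp
      (f := fun p => k (toPlane p)) (k.continuous.comp continuous_toPlane).continuousAt
  have hk' : k.symm 0 = 0 := by rw [Homeomorph.symm_apply_eq, hk]
  obtain ⟨h1, h2⟩ := key k hk
  obtain ⟨h3, h4⟩ := key k.symm hk'
  refine ⟨⟨⟨fun p => ofPlane (k (toPlane p)), fun p => ofPlane (k.symm (toPlane p)),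
    fun p => ?_, fun p => ?_⟩, h2, h4⟩, fun p => toPlane_ofPlane (h1 _ (toPlane_ne_zero p))⟩
  · change ofPlane (k.symm (toPlane (ofPlane (k (toPlane p))))) = p
    rw [toPlane_ofPlane (h1 _ (toPlane_ne_zero p)), k.symm_apply_apply, ofPlane_toPlane]
  · change ofPlane (k (toPlane (ofPlane (k.symm (toPlane p))))) = p
    rw [toPlane_ofPlane (h3 _ (toPlane_ne_zero p)), k.apply_symm_apply, ofPlane_toPlane]

/-- There is a compactly supported homeomorphism of the plane moving a given point to the origin. -/
theorem exists_plane_homeo_move {d : ℂ} (hd : d ≠ 0) :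
    ∃ σ : ℂ ≃ₜ ℂ, σ d = 0 ∧ ∀ w, 3 * ‖d‖ ≤ ‖w‖ → σ w = w := by
  have hd0 : 0 < ‖d‖ := norm_pos_iff.2 hd
  set f : ℂ → ℂ := fun w => w - (max 0 (1 - ‖w - d‖ / (2 * ‖d‖)) : ℝ) • d with hf
  have happ : ApproximatesLinearOn f ((ContinuousLinearEquiv.refl ℝ ℂ : ℂ ≃L[ℝ] ℂ) : ℂ →L[ℝ] ℂ)
      univ (1 / 2) := by
    intro x _ y _
    have h1 : f x - f y - ((ContinuousLinearEquiv.refl ℝ ℂ : ℂ ≃L[ℝ] ℂ) : ℂ →L[ℝ] ℂ) (x - y) =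
        ((max 0 (1 - ‖y - d‖ / (2 * ‖d‖)) - max 0 (1 - ‖x - d‖ / (2 * ‖d‖)) : ℝ)) • d := by
      simp only [hf, ContinuousLinearEquiv.coe_coe, ContinuousLinearEquiv.refl_apply]
      module
    rw [h1, norm_smul, Real.norm_eq_abs, max_comm 0, max_comm 0]
    have h2 := abs_max_sub_max_le_abs (1 - ‖y - d‖ / (2 * ‖d‖)) (1 - ‖x - d‖ / (2 * ‖d‖)) 0
    have h3 : (1 - ‖y - d‖ / (2 * ‖d‖)) - (1 - ‖x - d‖ / (2 * ‖d‖)) =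
        (‖x - d‖ - ‖y - d‖) / (2 * ‖d‖) := by ring
    have h4 := abs_norm_sub_norm_le (x - d) (y - d)
    rw [sub_sub_sub_cancel_right] at h4
    rw [h3, abs_div, abs_of_pos (by positivity : 0 < 2 * ‖d‖)] at h2
    calc _ ≤ |‖x - d‖ - ‖y - d‖| / (2 * ‖d‖) * ‖d‖ := by gcongr
      _ = |‖x - d‖ - ‖y - d‖| / 2 := by field_simp
      _ ≤ _ := by
        push_cast
        linarith
  refine ⟨happ.toHomeomorph f (.inr ?_), ?_, fun w hw => ?_⟩
  · have h1 : ‖((ContinuousLinearEquiv.refl ℝ ℂ).symm : ℂ →L[ℝ] ℂ)‖₊ = 1 :=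
      NNReal.eq ContinuousLinearMap.norm_id
    rw [h1, inv_one]
    exact NNReal.half_lt_self one_ne_zero
  · change f d = 0
    simp [hf]
  · change f w = w
    have : 2 * ‖d‖ ≤ ‖w - d‖ := by linarith [norm_sub_norm_le w d]
    simp only [hf]
    rw [max_eq_left, zero_smul, sub_zero]
    rw [sub_nonpos, one_le_div (by positivity)]
    exact this

/-- A homeomorphism which fixes the ends and is the identity near some point is in the commutator
subgroup. -/
theorem FixesEnds.mem_commutator_of_eventually_eq {h : (Circle × ℝ) ≃ₜ (Circle × ℝ)}
    (hh : FixesEnds h) {u : Circle × ℝ} (hu : ∀ᶠ p in 𝓝 u, h p = p) :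
    h ∈ commutator ((Circle × ℝ) ≃ₜ (Circle × ℝ)) := by
  obtain ⟨k, hk0, hk⟩ := hh.exists_plane
  set d := toPlane u with hd
  have hd0 : d ≠ 0 := toPlane_ne_zero u
  obtain ⟨σ, hσd, hσ⟩ := exists_plane_homeo_move hd0
  have hkd : ∀ᶠ w in 𝓝 d, k w = w := by
    have h1 : Tendsto ofPlane (𝓝 d) (𝓝 u) := by
      have := continuousAt_ofPlane hd0
      rwa [ContinuousAt, hd, ofPlane_toPlane] at this
    filter_upwards [h1.eventually hu, isOpen_ne.mem_nhds hd0] with w hw hw0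
    rw [← toPlane_ofPlane hw0, hk, hw]
  have hσ0 : σ.symm 0 = d := by rw [Homeomorph.symm_apply_eq, hσd]
  obtain ⟨g, hg⟩ := exists_of_plane (k := σ.symm.trans (k.trans σ)) (by
    simp only [Homeomorph.trans_apply, hσ0]
    rw [hkd.self_of_nhds, hσd])
  have hinj : Function.Injective toPlane := Function.LeftInverse.injective ofPlane_toPlane
  have hglow : ∃ a, ∀ p : Circle × ℝ, p.2 ≤ a → g p = p := by
    have h1 : Tendsto σ.symm (𝓝 0) (𝓝 d) := hσ0 ▸ σ.symm.continuous.tendsto 0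
    have h2 : ∀ᶠ p in lowerEnd, g p = p := by
      filter_upwards [(h1.comp tendsto_toPlane).eventually hkd] with p hp
      apply hinj
      rw [hg]
      simp only [Homeomorph.trans_apply]
      rw [show k (σ.symm (toPlane p)) = _ from hp]
      exact σ.apply_symm_apply _
    obtain ⟨s, hs, hsub⟩ := mem_comap.1 h2
    obtain ⟨a, ha⟩ := mem_atBot_sets.1 hs
    exact ⟨a, fun p hp => hsub (ha _ hp)⟩
  have hgup : ∃ a, ∀ p : Circle × ℝ, a ≤ p.2 → g p = h p := by
    have hlarge : ∀ᶠ p in upperEnd, 3 * ‖d‖ ≤ ‖toPlane p‖ := by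
      simp only [norm_toPlane]
      exact (Real.tendsto_exp_atTop.comp tendsto_comap).eventually_ge_atTop _
    have h2 : ∀ᶠ p in upperEnd, g p = h p := by
      filter_upwards [hlarge, hh.1.eventually hlarge] with p hp hp'
      apply hinj
      rw [hg]
      simp only [Homeomorph.trans_apply]
      rw [show σ.symm (toPlane p) = toPlane p by rw [Homeomorph.symm_apply_eq, hσ _ hp], hk,
        hσ _ hp']
    obtain ⟨s, hs, hsub⟩ := mem_comap.1 h2
    obtain ⟨a, ha⟩ := mem_atTop_sets.1 hs
    exact ⟨a, fun p hp => hsub (ha _ hp)⟩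
  obtain ⟨a, ha⟩ := hglow
  obtain ⟨b, hb⟩ := hgup
  have h1 := mem_commutator_of_eq_id_below ha
  have h2 : g⁻¹ * h ∈ commutator ((Circle × ℝ) ≃ₜ (Circle × ℝ)) :=
    mem_commutator_of_eq_id_above (a := b) fun p hp => by
      change g.symm (h p) = p
      rw [Homeomorph.symm_apply_eq, hb p hp]
  have := mul_mem h1 h2
  rwa [mul_inv_cancel_left] at this

/-- A homeomorphism of the strip supported in a small box induces one of the annulus. -/
theorem exists_annulus_homeo_of_box (H : (ℝ × ℝ) ≃ₜ (ℝ × ℝ))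
    (hH : ∀ p : ℝ × ℝ, 1 ≤ |p.1| ∨ 2 ≤ |p.2| → H p = p) :
    ∃ k : (Circle × ℝ) ≃ₜ (Circle × ℝ),
      (∀ p : ℝ × ℝ, |p.1| < 1 → k (Circle.exp p.1, p.2) = (Circle.exp (H p).1, (H p).2)) ∧
      ∀ p, 2 ≤ |p.2| → k p = p := by
  set s : Circle × ℝ → ℝ × ℝ := fun p => (Complex.arg p.1, p.2) with hs
  set r : ℝ × ℝ → Circle × ℝ := fun p => (Circle.exp p.1, p.2) with hr
  have hrs : ∀ p, r (s p) = p := fun p => Prod.ext (Circle.exp_arg p.1) rfl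
  have hsr : ∀ p : ℝ × ℝ, |p.1| < 1 → s (r p) = p := fun p hp => by
    have := abs_lt.1 hp
    exact Prod.ext (Circle.arg_exp (by linarith [Real.pi_gt_three])
      (by linarith [Real.pi_gt_three]))
      rfl
  have hcont : ∀ H : (ℝ × ℝ) ≃ₜ (ℝ × ℝ), (∀ p : ℝ × ℝ, 1 ≤ |p.1| ∨ 2 ≤ |p.2| → H p = p) →
      Continuous fun p => r (H (s p)) := by
    intro H hH
    have hrc : Continuous r := by fun_prop
    refine continuous_iff_continuousAt.2 fun p => ?_
    rcases lt_or_ge (p.1 : ℂ).re 0 with hp | hp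
    · refine continuousAt_id.congr ?_
      have : IsOpen {q : Circle × ℝ | (q.1 : ℂ).re < 0} :=
        isOpen_lt (by fun_prop) continuous_const
      filter_upwards [this.mem_nhds hp] with q hq
      have h1 : Real.pi / 2 < |Complex.arg q.1| := by
        by_contra! hcon
        exact absurd (Complex.abs_arg_le_pi_div_two_iff.1 hcon) (not_le.2 hq)
      rw [hH (s q) (.inl (by simp only [hs]; linarith [Real.pi_gt_three])), hrs, id]
    · refine (hrc.comp H.continuous).continuousAt.comp (f := s) ?_
      refine ContinuousAt.prodMk ?_ continuousAt_snd
      refine ContinuousAt.comp (g := Complex.arg) (f := fun q : Circle × ℝ => (q.1 : ℂ))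
        (Complex.continuousAt_arg ?_) (by fun_prop)
      rw [Complex.mem_slitPlane_iff_arg]
      refine ⟨fun h => ?_, Circle.coe_ne_zero _⟩
      have := Complex.abs_arg_le_pi_div_two_iff.2 hp
      rw [h, abs_of_pos Real.pi_pos] at this
      linarith [Real.pi_pos]
  have hinv : ∀ H : (ℝ × ℝ) ≃ₜ (ℝ × ℝ), (∀ p : ℝ × ℝ, 1 ≤ |p.1| ∨ 2 ≤ |p.2| → H p = p) →
      ∀ p, r (H.symm (s (r (H (s p))))) = p := by
    intro H hH p
    by_cases hp : 1 ≤ |(s p).1| ∨ 2 ≤ |(s p).2|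
    · rw [hH _ hp, hrs, H.symm_apply_eq.2 (hH _ hp).symm, hrs]
    · have : |(H (s p)).1| < 1 := by
        by_contra! hcon
        have h1 := H.injective (hH _ (.inl hcon))
        rw [h1] at hcon
        exact hp (.inl hcon)
      rw [hsr _ this, H.symm_apply_apply, hrs]
  have hH' : ∀ p : ℝ × ℝ, 1 ≤ |p.1| ∨ 2 ≤ |p.2| → H.symm p = p :=
    fun p hp => H.symm_apply_eq.2 (hH p hp).symm
  refine ⟨⟨⟨fun p => r (H (s p)), fun p => r (H.symm (s p)), hinv H hH, hinv H.symm hH'⟩,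
    hcont H hH, hcont H.symm hH'⟩, fun p hp => ?_, fun p hp => ?_⟩
  · change r (H (s (r p))) = r (H p)
    rw [hsr p hp]
  · change r (H (s p)) = p
    rw [hH _ (.inr hp), hrs]

theorem mul_growth_le_sub {W : ℝ → ℝ} (hW : Monotone W) (hW0 : ∀ t, 0 ≤ W t) {x y : ℝ}
    (hxy : x ≤ y) : (y - x) / 2 * (1 + W (((y - x) / 2) ^ 2)) ≤
      y * (1 + W (y ^ 2)) - x * (1 + W (x ^ 2)) := by
  set d := (y - x) / 2 with hd
  have hd0 : 0 ≤ d := by linarith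
  have key : ∀ z, d ≤ z → d * (1 + W (d ^ 2)) ≤ z * (1 + W (z ^ 2)) := fun z hz => by
    have := hW (pow_le_pow_left₀ hd0 hz 2)
    have := hW0 (d ^ 2)
    have := hd0.trans hz
    gcongr
  rcases le_total 0 x with hx | hx
  · have h1 := hW (pow_le_pow_left₀ hx hxy 2)
    have h2 := hW (pow_le_pow_left₀ hd0 (by linarith : d ≤ y) 2)
    have h3 : x * (1 + W (x ^ 2)) ≤ x * (1 + W (y ^ 2)) := by gcongr
    have h4 : d * (1 + W (d ^ 2)) ≤ (y - x) * (1 + W (y ^ 2)) := by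
      have := hW0 (d ^ 2)
      gcongr
      linarith
    linarith
  · rcases le_total 0 y with hy | hy
    · have hx' := hW0 (x ^ 2)
      have hy' := hW0 (y ^ 2)
      rcases le_total d y with h | h
      · have := key y h
        nlinarith
      · have := key (-x) (by linarith)
        rw [neg_sq] at this
        nlinarith
    · have h1 := hW (pow_le_pow_left₀ (by linarith : 0 ≤ -y) (by linarith : -y ≤ -x) 2)
      have h2 := hW (pow_le_pow_left₀ hd0 (by linarith : d ≤ -x) 2)
      rw [neg_sq, neg_sq] at h1
      rw [neg_sq] at h2
      have h3 : -y * (1 + W (y ^ 2)) ≤ -y * (1 + W (x ^ 2)) := by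
        have : 0 ≤ -y := by linarith
        gcongr
      have h4 : d * (1 + W (d ^ 2)) ≤ (y - x) * (1 + W (x ^ 2)) := by
        have := hW0 (d ^ 2)
        gcongr
        linarith
      linarith

/-- A reparametrisation of the line which makes displacements of prescribed growth sublinear. -/
theorem exists_orderIso_sqrt_growth {W : ℝ → ℝ} (hWc : Continuous W) (hW : Monotone W)
    (hW0 : ∀ t, 0 ≤ W t) : ∃ (Ω : ℝ ≃o ℝ) (C : ℝ), Ω 0 = 0 ∧ Ω 2 = 1 ∧ Ω (-2) = -1 ∧
      ∀ x y t, 0 ≤ t → |Ω x - Ω y| ≤ W t → |x - y| ≤ C * (1 + √t) := by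
  set s : ℝ := 1 / (2 * (1 + W 4)) with hs
  have hs0 : 0 < s := by have := hW0 4; positivity
  have hs1 : s ≤ 1 := by
    have := hW0 4
    rw [hs, div_le_one (by positivity)]
    linarith
  set f : ℝ → ℝ := fun x => s * (x * (1 + W (x ^ 2))) with hf
  have hinc : ∀ {x y : ℝ}, x ≤ y → s * ((y - x) / 2 * (1 + W (((y - x) / 2) ^ 2))) ≤ f y - f x :=
    fun {x y} hxy => by
      have := mul_le_mul_of_nonneg_left (mul_growth_le_sub hW hW0 hxy) hs0.le
      simp only [hf]
      linarith
  have hmono : StrictMono f := fun x y hxy => by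
    have h1 := hinc hxy.le
    have h2 : 0 < s * ((y - x) / 2 * (1 + W (((y - x) / 2) ^ 2))) := by
      have := hW0 (((y - x) / 2) ^ 2)
      have : 0 < y - x := by linarith
      positivity
    linarith
  have hf0 : f 0 = 0 := by simp [hf]
  have hge : ∀ x, 0 ≤ x → s * x ≤ f x := fun x hx => by
    have := mul_nonneg hx (hW0 (x ^ 2))
    have := mul_nonneg hs0.le this
    simp only [hf]
    linarith
  have hodd : ∀ x, f (-x) = -f x := fun x => by
    simp only [hf, neg_sq]
    ring
  have htop : Tendsto f atTop atTop :=
    tendsto_atTop_mono' _ ((eventually_ge_atTop 0).mono hge) (tendsto_id.const_mul_atTop hs0)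
  have hbot : Tendsto f atBot atBot := by
    have := tendsto_neg_atTop_atBot.comp (htop.comp tendsto_neg_atBot_atTop)
    refine this.congr fun x => ?_
    simp [hodd]
  obtain ⟨Ω, hΩ⟩ := exists_orderIso_of_strictMono hmono (by fun_prop) htop hbot
  have h2 : f 2 = 1 := by
    have : 1 + W 4 ≠ 0 := by have := hW0 4; positivity
    simp only [hf, hs]
    norm_num
    field_simp
  have key : ∀ x y t, 0 ≤ t → x ≤ y → f y - f x ≤ W t → y - x ≤ 2 / s * (1 + √t) := by
    intro x y t ht hxy hle
    by_contra! hcon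
    set d := (y - x) / 2 with hd
    have hd1 : 1 / s * (1 + √t) < d := by
      rw [hd]
      linarith [show 2 / s * (1 + √t) = 2 * (1 / s * (1 + √t)) by ring]
    have hsd : 1 + √t < s * d := by
      have := mul_lt_mul_of_pos_left hd1 hs0
      rwa [← mul_assoc, mul_one_div_cancel hs0.ne', one_mul] at this
    have hsq := Real.sqrt_nonneg t
    have hd0 : 0 < d := by
      by_contra! h
      nlinarith
    have hdt : t ≤ d ^ 2 := by
      rw [← Real.sqrt_le_left hd0.le]
      nlinarith
    have h1 := hinc hxy
    have h3 := hW hdt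
    have h4 := hW0 (d ^ 2)
    rw [← hd, ← mul_assoc] at h1
    nlinarith
  refine ⟨Ω, 2 / s, by rw [hΩ, hf0], by rw [hΩ, h2], by rw [hΩ, hodd, h2], fun x y t ht h => ?_⟩
  rw [hΩ, hΩ] at h
  rcases le_total x y with hxy | hxy
  · rw [abs_sub_comm] at h ⊢
    rw [abs_of_nonneg (by linarith)]
    exact key x y t ht hxy ((le_abs_self _).trans h)
  · rw [abs_of_nonneg (by linarith)]
    exact key y x t ht hxy ((le_abs_self _).trans h)

/-- The homeomorphisms of the annulus whose circle coordinate is, up to a null-homotopic factor,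
the projection. -/
def DegreeOne (h : (Circle × ℝ) ≃ₜ (Circle × ℝ)) : Prop :=
  ∃ u : Circle × ℝ → ℝ, Continuous u ∧ ∀ p, (h p).1 = p.1 * Circle.exp (u p)

theorem DegreeOne.mul {g h : (Circle × ℝ) ≃ₜ (Circle × ℝ)} (hg : DegreeOne g) (hh : DegreeOne h) :
    DegreeOne (g * h) := by
  obtain ⟨u, hu, hgu⟩ := hg
  obtain ⟨v, hv, hhv⟩ := hh
  refine ⟨fun p => v p + u (h p), hv.add (hu.comp h.continuous), fun p => ?_⟩
  change (g (h p)).1 = _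
  rw [hgu, hhv, Circle.exp_add, mul_assoc]

theorem eq_mul_exp_neg_symm {h : (Circle × ℝ) ≃ₜ (Circle × ℝ)} {u : Circle × ℝ → ℝ}
    (hu : ∀ p, (h p).1 = p.1 * Circle.exp (u p)) (p : Circle × ℝ) :
    (h.symm p).1 = p.1 * Circle.exp (-u (h.symm p)) := by
  have := hu (h.symm p)
  rw [h.apply_symm_apply] at this
  rw [this, Circle.exp_neg, mul_inv_cancel_right]

theorem DegreeOne.inv {h : (Circle × ℝ) ≃ₜ (Circle × ℝ)} (hh : DegreeOne h) : DegreeOne h⁻¹ := by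
  obtain ⟨u, hu, hhu⟩ := hh
  exact ⟨fun p => -u (h.symm p), (hu.comp h.symm.continuous).neg, eq_mul_exp_neg_symm hhu⟩

theorem degreeOne_heightHomeo (e : ℝ ≃ₜ ℝ) : DegreeOne (heightHomeo e) :=
  ⟨0, continuous_const, fun p => by simp [heightHomeo_apply]⟩

/-- The lift to the strip of a homeomorphism of the annulus of degree one. -/
theorem exists_lift {h : (Circle × ℝ) ≃ₜ (Circle × ℝ)} {u : Circle × ℝ → ℝ} (hu : Continuous u)
    (hhu : ∀ p, (h p).1 = p.1 * Circle.exp (u p)) :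
    ∃ H : (ℝ × ℝ) ≃ₜ (ℝ × ℝ),
      (∀ p, H p = (p.1 + u (Circle.exp p.1, p.2), (h (Circle.exp p.1, p.2)).2)) ∧
      ∀ p, H.symm p = (p.1 - u (h.symm (Circle.exp p.1, p.2)),
        (h.symm (Circle.exp p.1, p.2)).2) := by
  set F : ℝ × ℝ → ℝ × ℝ := fun p => (p.1 + u (Circle.exp p.1, p.2), (h (Circle.exp p.1, p.2)).2)
    with hF
  set F' : ℝ × ℝ → ℝ × ℝ := fun p => (p.1 - u (h.symm (Circle.exp p.1, p.2)),
    (h.symm (Circle.exp p.1, p.2)).2) with hF'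
  have h1 : ∀ p : ℝ × ℝ, (Circle.exp (F p).1, (F p).2) = h (Circle.exp p.1, p.2) := fun p =>
    Prod.ext (by rw [hhu, hF, Circle.exp_add]) rfl
  have h2 : ∀ p : ℝ × ℝ, (Circle.exp (F' p).1, (F' p).2) = h.symm (Circle.exp p.1, p.2) := fun p =>
    Prod.ext (by rw [eq_mul_exp_neg_symm hhu, ← Circle.exp_add, ← sub_eq_add_neg]) rfl
  refine ⟨⟨⟨F, F', fun p => ?_, fun p => ?_⟩, by dsimp only; fun_prop, by dsimp only; fun_prop⟩,
    fun p => rfl, fun p => rfl⟩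
  · change ((F p).1 - u (h.symm (Circle.exp (F p).1, (F p).2)),
      (h.symm (Circle.exp (F p).1, (F p).2)).2) = p
    rw [h1, h.symm_apply_apply, hF, add_sub_cancel_right]
  · change ((F' p).1 + u (Circle.exp (F' p).1, (F' p).2), (h (Circle.exp (F' p).1, (F' p).2)).2) = p
    rw [h2, h.apply_symm_apply, hF', sub_add_cancel]

/-- A degree one homeomorphism which moves heights by a bounded amount and fixes a point agrees near
this point with a compactly supported homeomorphism. -/
theorem exists_compactSupport_eq_near {h : (Circle × ℝ) ≃ₜ (Circle × ℝ)} (hh : DegreeOne h)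
    (h0 : h (1, 0) = (1, 0)) {M : ℝ} (hM : ∀ p, |(h p).2 - p.2| ≤ M)
    (hM' : ∀ p, |(h.symm p).2 - p.2| ≤ M) :
    ∃ k : (Circle × ℝ) ≃ₜ (Circle × ℝ), (∀ᶠ p in 𝓝 (1, 0), k p = h p) ∧
      ∀ p, 2 ≤ |p.2| → k p = p := by
  obtain ⟨u', hu'c, hhu'⟩ := hh
  obtain ⟨u, hu, hhu, hu0⟩ : ∃ u : Circle × ℝ → ℝ, Continuous u ∧
      (∀ p, (h p).1 = p.1 * Circle.exp (u p)) ∧ u (1, 0) = 0 := by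
    refine ⟨fun p => u' p - u' (1, 0), by fun_prop, fun p => ?_, sub_self _⟩
    have := hhu' (1, 0)
    rw [h0, one_mul] at this
    rw [hhu', Circle.exp_sub, ← this, div_one]
  obtain ⟨H, hH, hHs⟩ := exists_lift hu hhu
  have hH0 : H (0, 0) = (0, 0) := by
    rw [hH, Circle.exp_zero, hu0, h0, add_zero]
  obtain ⟨W, hWc, hWm, hW0, hW⟩ := exists_monotone_bound
    (m := fun p => |u p| + |u (h.symm p)|) (by fun_prop)
  obtain ⟨Ω, C, hΩ0, hΩ2, hΩ2', hΩ⟩ := exists_orderIso_sqrt_growth hWc hWm hW0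
  have hM0 : 0 ≤ M := (abs_nonneg _).trans (hM 1)
  have hC0 : 0 ≤ C := by
    have := (abs_nonneg _).trans (hΩ 0 0 0 le_rfl (by simp [hW0]))
    simpa using this
  set Φ : (ℝ × ℝ) ≃ₜ (ℝ × ℝ) := Ω.toHomeomorph.prodCongr (Homeomorph.refl ℝ) with hΦ
  have hΦa : ∀ p, Φ p = (Ω p.1, p.2) := fun p => rfl
  have hΦs : ∀ p, Φ.symm p = (Ω.symm p.1, p.2) := fun p => rfl
  have hbound : ∀ F : (ℝ × ℝ) ≃ₜ (ℝ × ℝ), (∀ p, |(F p).1 - p.1| ≤ W |p.2|) →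
      (∀ p, |(F p).2 - p.2| ≤ M) → ∀ p, ‖Φ.symm (F (Φ p)) - p‖ ≤ (C + M) * (1 + √‖p‖) := by
    intro F hF1 hF2 p
    have hp2 : |p.2| ≤ ‖p‖ := norm_snd_le p
    have hsq := Real.sqrt_nonneg ‖p‖
    rw [hΦs, hΦa, Prod.norm_def, max_le_iff]
    constructor
    · change |Ω.symm _ - p.1| ≤ _
      have := hΩ (Ω.symm (F (Ω p.1, p.2)).1) p.1 |p.2| (abs_nonneg _) (by
        rw [Ω.apply_symm_apply]
        exact hF1 (Ω p.1, p.2))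
      have h3 := Real.sqrt_le_sqrt hp2
      nlinarith
    · change |_ - p.2| ≤ _
      have := hF2 (Ω p.1, p.2)
      dsimp only at this ⊢
      nlinarith
  obtain ⟨K, hK0, hK⟩ := exists_homeo_eq_near_zero ((Φ.trans H).trans Φ.symm)
    (by
      change Φ.symm (H (Φ 0)) = 0
      have : Φ 0 = (0, 0) := by rw [hΦa]; exact Prod.ext hΩ0 rfl
      rw [this, hH0, Φ.symm_apply_eq, this])
    (hbound H (fun p => by
      rw [hH, add_sub_cancel_left]
      have := hW (Circle.exp p.1) p.2 _ le_rfl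
      rw [abs_of_nonneg (by positivity)] at this
      linarith [abs_nonneg (u (h.symm (Circle.exp p.1, p.2)))]) fun p => by rw [hH]; exact hM _)
    (hbound H.symm (fun p => by
      rw [hHs, sub_sub_cancel_left, abs_neg]
      have := hW (Circle.exp p.1) p.2 _ le_rfl
      rw [abs_of_nonneg (by positivity)] at this
      linarith [abs_nonneg (u (Circle.exp p.1, p.2))]) fun p => by rw [hHs]; exact hM' _)
  set L := (Φ.symm.trans K).trans Φ with hL
  have hLa : ∀ p, L p = Φ (K (Φ.symm p)) := fun p => rfl
  obtain ⟨k, hk, hk2⟩ := exists_annulus_homeo_of_box L fun p hp => by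
    rw [hLa, hK, Φ.apply_symm_apply]
    rw [hΦs, Prod.norm_def, le_max_iff]
    refine hp.imp (fun hp => ?_) id
    change 2 ≤ |_|
    rw [le_abs'] at hp ⊢
    refine hp.imp (fun hp => ?_) fun hp => ?_
    · rwa [OrderIso.symm_apply_le, hΩ2']
    · rwa [OrderIso.le_symm_apply, hΩ2]
  refine ⟨k, ?_, hk2⟩
  have hs : Tendsto (fun p : Circle × ℝ => (Complex.arg p.1, p.2)) (𝓝 (1, 0)) (𝓝 (0, 0)) := by
    have h1 : ContinuousAt (fun p : Circle × ℝ => (Complex.arg p.1, p.2)) (1, 0) :=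
      ContinuousAt.prodMk (ContinuousAt.comp (g := Complex.arg)
        (f := fun q : Circle × ℝ => (q.1 : ℂ))
        (Complex.continuousAt_arg (by simp)) (by fun_prop)) continuousAt_snd
    simpa [ContinuousAt] using h1
  have hΦ0 : Tendsto Φ.symm (𝓝 (0, 0)) (𝓝 0) := by
    have : Φ.symm (0, 0) = 0 := by
      rw [Φ.symm_apply_eq, hΦa]
      exact Prod.ext hΩ0.symm rfl
    exact this ▸ Φ.symm.continuous.tendsto (0, 0)
  have hclose : ∀ᶠ q : ℝ × ℝ in 𝓝 (0, 0), |q.1| < 1 :=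
    (continuous_fst.abs.tendsto ((0, 0) : ℝ × ℝ)).eventually_lt_const (by simp)
  filter_upwards [hs.eventually hclose, hs.eventually (hΦ0.eventually hK0)] with p hp1 hp2
  have := hk (Complex.arg p.1, p.2) hp1
  rw [Circle.exp_arg] at this
  change k p = _ at this
  rw [this, hLa, hp2]
  change (Circle.exp (Φ (Φ.symm (H (Φ (Φ.symm _))))).1, (Φ (Φ.symm (H (Φ (Φ.symm _))))).2) = _
  rw [Φ.apply_symm_apply, Φ.apply_symm_apply, hH, Circle.exp_add, Circle.exp_arg]
  exact Prod.ext (hhu p).symm rfl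

/-- A symmetric reparametrisation of the line turning maps of prescribed growth into maps which
increase the absolute value by a bounded amount. -/
theorem exists_orderIso_bounded_growth {W : ℝ → ℝ} (hWc : Continuous W) (hW : Monotone W)
    (hW0 : ∀ t, 0 ≤ W t) : ∃ (e : ℝ ≃o ℝ) (k : ℝ), e 0 = 0 ∧
      ∀ t a, |a| ≤ W |e t| → |e.symm a| ≤ |t| + k := by
  set k := 1 + W 0 with hk
  have hk1 : 1 ≤ k := by linarith [hW0 0]
  obtain ⟨v, hv⟩ := exists_orderIso_of_strictMono (f := fun t => t + 1 + W (max t 0))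
    (fun x y hxy => by
      have := hW (max_le_max_right 0 hxy.le)
      change x + 1 + W (max x 0) < y + 1 + W (max y 0)
      linarith) (by fun_prop)
    (tendsto_atTop_mono (fun t => by have := hW0 (max t 0); simp only [id]; linarith) tendsto_id)
    ((tendsto_atBot_add_const_right _ k tendsto_id).congr' (by
      filter_upwards [eventually_le_atBot 0] with t ht
      rw [max_eq_right ht, hk, id]
      ring))
  have hvneg : ∀ t ≤ 0, v t = t + k := fun t ht => by
    rw [hv, max_eq_right ht, hk]
    ring
  have hvs : ∀ t < 1, v.symm t = t - k := fun t ht => by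
    rw [OrderIso.symm_apply_eq, hvneg _ (by linarith)]
    ring
  obtain ⟨c, hc, hcid⟩ := exists_conj_of_eqOn v.symm.toHomeomorph (Homeomorph.addRight (-k))
    (A := Iio 1) isOpen_Iio (fun t ht => hvs t ht) (fun t ht => by
      change t + -k < 1
      linarith [mem_Iio.1 ht])
    (exists_iterate_lt (η := id) (fun t => by
      change t + -k ≤ t - 1
      linarith) 1)
    (exists_iterate_lt (η := id) (fun t => by
      change v.symm t ≤ t - 1
      rw [OrderIso.symm_apply_le, hv]
      linarith [hW0 (max (t - 1) 0)]) 1)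
  have hcv : ∀ t, c (t + k) = v (c t) := fun t => by
    have : v.symm (c (t + k)) = c (t + k + -k) := hc (t + k)
    rw [OrderIso.symm_apply_eq] at this
    rw [this, add_neg_cancel_right]
  have hc0 : c 0 = 0 := hcid (by simp)
  have hcm : StrictMono c := by
    refine (c.continuous.strictMono_of_inj c.injective).resolve_right fun h => ?_
    have h1 : c (-1) = -1 := hcid (by simp)
    have := h (by norm_num : (-1 : ℝ) < 0)
    rw [h1, hc0] at this
    linarith
  have hctop : Tendsto c atTop atTop := (hcm.orderIsoOfSurjective c c.surjective).tendsto_atTop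
  set f : ℝ → ℝ := fun t => c (max t 0) - c (max (-t) 0) with hf
  have hfpos : ∀ t, 0 ≤ t → f t = c t := fun t ht => by
    simp only [hf]
    rw [max_eq_left ht, max_eq_right (by linarith), hc0, sub_zero]
  have hfodd : ∀ t, f (-t) = -f t := fun t => by simp [hf]
  have hfm : StrictMono f := by
    intro s t hst
    have h1 := hcm.monotone (max_le_max_right 0 hst.le)
    have h2 := hcm.monotone (max_le_max_right 0 (neg_le_neg hst.le))
    simp only [hf]
    rcases lt_or_ge 0 t with ht | ht
    · have := hcm (show max s 0 < max t 0 by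
        rw [max_eq_left ht.le]
        exact max_lt hst ht)
      linarith
    · have := hcm (show max (-t) 0 < max (-s) 0 by
        rw [max_eq_left (by linarith), max_eq_left (by linarith)]
        linarith)
      linarith
  have hftop : Tendsto f atTop atTop :=
    hctop.congr' ((eventually_ge_atTop 0).mono fun t ht => (hfpos t ht).symm)
  have hfbot : Tendsto f atBot atBot := by
    have := tendsto_neg_atTop_atBot.comp (hftop.comp tendsto_neg_atBot_atTop)
    refine this.congr fun x => ?_
    simp [hfodd]
  obtain ⟨e, he⟩ := exists_orderIso_of_strictMono hfm (by fun_prop) hftop hfbot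
  have hef : ∀ t, |e t| = c |t| := fun t => by
    rw [he]
    rcases le_total 0 t with ht | ht
    · rw [hfpos t ht, abs_of_nonneg ht, abs_of_nonneg]
      rw [← hc0]
      exact hcm.monotone ht
    · have := hfpos (-t) (by linarith)
      rw [← abs_neg, ← hfodd, this, abs_of_nonpos ht, abs_of_nonneg]
      rw [← hc0]
      exact hcm.monotone (by linarith)
  refine ⟨e, k, by rw [he, hfpos 0 le_rfl, hc0], fun t a ha => ?_⟩
  have hck : |a| ≤ e (|t| + k) := by
    rw [he, hfpos _ (by positivity), hcv, hv, ← hef, max_eq_left (abs_nonneg _)]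
    linarith [abs_nonneg (e t)]
  rw [abs_le] at hck ⊢
  rw [OrderIso.le_symm_apply, OrderIso.symm_apply_le]
  refine ⟨?_, hck.2⟩
  rw [he, hfodd, ← he]
  exact hck.1

theorem FixesEnds.exists_sign {h : (Circle × ℝ) ≃ₜ (Circle × ℝ)} (hh : FixesEnds h) :
    ∃ T, 0 ≤ T ∧ (∀ p : Circle × ℝ, T ≤ p.2 → 0 ≤ (h p).2) ∧
      ∀ p : Circle × ℝ, p.2 ≤ -T → (h p).2 ≤ 0 := by
  have h1 : ∀ᶠ p in upperEnd, 0 ≤ (h p).2 := (tendsto_comap_iff.1 hh.1).eventually_ge_atTop 0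
  have h2 : ∀ᶠ p in lowerEnd, (h p).2 ≤ 0 := (tendsto_comap_iff.1 hh.2).eventually_le_atBot 0
  obtain ⟨s, hs, hs'⟩ := mem_comap.1 h1
  obtain ⟨a, ha⟩ := mem_atTop_sets.1 hs
  obtain ⟨r, hr, hr'⟩ := mem_comap.1 h2
  obtain ⟨b, hb⟩ := mem_atBot_sets.1 hr
  refine ⟨|a| + |b|, by positivity, fun p hp => hs' (ha _ ?_), fun p hp => hr' (hb _ ?_)⟩
  · linarith [le_abs_self a, abs_nonneg b]
  · linarith [neg_abs_le b, abs_nonneg a]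

theorem FixesEnds.exists_height_bound {h : (Circle × ℝ) ≃ₜ (Circle × ℝ)} (hh : FixesEnds h) {k : ℝ}
    (hk : ∀ p, |(h p).2| ≤ |p.2| + k) (hk' : ∀ p, |(h.symm p).2| ≤ |p.2| + k) :
    ∃ M, ∀ p, |(h p).2 - p.2| ≤ M := by
  obtain ⟨T, hT, h1, h2⟩ := hh.exists_sign
  refine ⟨2 * T + k, fun p => ?_⟩
  have h3 := hk p
  have h4 := hk' (h p)
  rw [h.symm_apply_apply] at h4
  rw [abs_le]
  rcases le_total T p.2 with hp | hp
  · rw [abs_of_nonneg (h1 p hp), abs_of_nonneg (hT.trans hp)] at h3 h4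
    constructor <;> linarith
  · rcases le_total p.2 (-T) with hp' | hp'
    · rw [abs_of_nonpos (h2 p hp'), abs_of_nonpos (by linarith)] at h3 h4
      constructor <;> linarith
    · have h5 : |p.2| ≤ T := abs_le.2 ⟨hp', hp⟩
      have h6 := abs_le.1 (h3.trans (add_le_add_left h5 k))
      constructor <;> linarith [h6.1, h6.2]

theorem fixesEnds_of_eq_id {h : (Circle × ℝ) ≃ₜ (Circle × ℝ)} {T : ℝ}
    (hh : ∀ p : Circle × ℝ, T ≤ |p.2| → h p = p) : FixesEnds h := by
  constructor
  · refine tendsto_id.congr' ?_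
    filter_upwards [tendsto_comap.eventually_ge_atTop T] with p hp
    exact (hh p (hp.trans (le_abs_self _))).symm
  · refine tendsto_id.congr' ?_
    filter_upwards [tendsto_comap.eventually_le_atBot (-T)] with p hp
    exact (hh p (by linarith [neg_le_abs p.2])).symm

theorem fixesEnds_heightHomeo (e : ℝ ≃o ℝ) : FixesEnds (heightHomeo e.toHomeomorph) :=
  ⟨tendsto_comap_iff.2 (e.tendsto_atTop.comp tendsto_comap),
    tendsto_comap_iff.2 (e.tendsto_atBot.comp tendsto_comap)⟩

theorem FixesEnds.mem_commutator_of_bounded {h : (Circle × ℝ) ≃ₜ (Circle × ℝ)} (hh : FixesEnds h)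
    (hd : DegreeOne h) (h0 : h (1, 0) = (1, 0)) {M : ℝ} (hM : ∀ p, |(h p).2 - p.2| ≤ M)
    (hM' : ∀ p, |(h.symm p).2 - p.2| ≤ M) : h ∈ commutator ((Circle × ℝ) ≃ₜ (Circle × ℝ)) := by
  obtain ⟨k, hk, hk2⟩ := exists_compactSupport_eq_near hd h0 hM hM'
  have hkc : k ∈ commutator ((Circle × ℝ) ≃ₜ (Circle × ℝ)) :=
    mem_commutator_of_eq_id_below (a := -2) fun p hp => hk2 p (by linarith [neg_le_abs p.2])
  have h1 : k⁻¹ * h ∈ commutator ((Circle × ℝ) ≃ₜ (Circle × ℝ)) := by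
    refine ((fixesEnds_of_eq_id hk2).inv.mul hh).mem_commutator_of_eventually_eq (u := (1, 0)) ?_
    filter_upwards [hk] with p hp
    change k.symm (h p) = p
    rw [← hp, k.symm_apply_apply]
  have := mul_mem hkc h1
  rwa [mul_inv_cancel_left] at this

theorem FixesEnds.mem_commutator_of_fixed {h : (Circle × ℝ) ≃ₜ (Circle × ℝ)} (hh : FixesEnds h)
    (hd : DegreeOne h) (h0 : h (1, 0) = (1, 0)) :
    h ∈ commutator ((Circle × ℝ) ≃ₜ (Circle × ℝ)) := by
  obtain ⟨W, hWc, hWm, hW0, hW⟩ := exists_monotone_bound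
    (m := fun p => |(h p).2| + |(h.symm p).2|) (by fun_prop)
  obtain ⟨e, k, he0, he⟩ := exists_orderIso_bounded_growth hWc hWm hW0
  set c := heightHomeo e.toHomeomorph with hc
  have hce : FixesEnds c := fixesEnds_heightHomeo e
  rw [← commutator_conj_mem_iff c⁻¹, inv_inv]
  set g := c⁻¹ * h * c with hg
  have hge : FixesEnds g := (hce.inv.mul hh).mul hce
  have hga : ∀ p : Circle × ℝ, g p = ((h (p.1, e p.2)).1, e.symm (h (p.1, e p.2)).2) := fun p => rfl
  have hgs : ∀ p : Circle × ℝ, g.symm p =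
      ((h.symm (p.1, e p.2)).1, e.symm (h.symm (p.1, e p.2)).2) :=
    fun p => rfl
  have hb : ∀ p, |(g p).2| ≤ |p.2| + k := fun p => by
    rw [hga]
    refine he p.2 _ ?_
    have := hW p.1 (e p.2) _ le_rfl
    rw [abs_of_nonneg (by positivity)] at this
    linarith [abs_nonneg (h.symm (p.1, e p.2)).2]
  have hb' : ∀ p, |(g.symm p).2| ≤ |p.2| + k := fun p => by
    rw [hgs]
    refine he p.2 _ ?_
    have := hW p.1 (e p.2) _ le_rfl
    rw [abs_of_nonneg (by positivity)] at this
    linarith [abs_nonneg (h (p.1, e p.2)).2]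
  obtain ⟨M, hM⟩ := hge.exists_height_bound hb hb'
  obtain ⟨M', hM'⟩ := hge.inv.exists_height_bound (k := k) hb' hb
  have hcd : DegreeOne c := degreeOne_heightHomeo _
  refine hge.mem_commutator_of_bounded ((hcd.inv.mul hd).mul hcd) ?_
    (fun p => (hM p).trans (le_max_left M M')) fun p => (hM' p).trans (le_max_right M M')
  rw [hga, he0, h0]
  exact Prod.ext rfl (by rw [OrderIso.symm_apply_eq, he0])

/-- The reflection of the annulus in the circle coordinate. -/
noncomputable def circleInv : (Circle × ℝ) ≃ₜ (Circle × ℝ) :=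
  (Homeomorph.inv Circle).prodCongr (Homeomorph.refl ℝ)

theorem circleInv_apply (p : Circle × ℝ) : circleInv p = (p.1⁻¹, p.2) := rfl

theorem fixesEnds_circleInv : FixesEnds circleInv :=
  ⟨tendsto_comap_iff.2 tendsto_comap, tendsto_comap_iff.2 tendsto_comap⟩

/-- The translations of the annulus. -/
noncomputable def annulusTranslate (q : Circle × ℝ) : (Circle × ℝ) ≃ₜ (Circle × ℝ) :=
  (Homeomorph.mulRight q.1).prodCongr (Homeomorph.addRight q.2)

theorem annulusTranslate_mem_commutator (q : Circle × ℝ) :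
    annulusTranslate q ∈ commutator ((Circle × ℝ) ≃ₜ (Circle × ℝ)) := by
  set w := Circle.exp (Complex.arg q.1 / 2) with hw
  have hww : w * w = q.1 := by rw [hw, ← Circle.exp_add, add_halves, Circle.exp_arg]
  have : annulusTranslate q = annulusTranslate (w, q.2 / 2) * (circleInv * heightNeg) *
      (annulusTranslate (w, q.2 / 2))⁻¹ * (circleInv * heightNeg)⁻¹ := by
    refine Homeomorph.ext fun p => ?_
    change (p.1 * q.1, p.2 + q.2) = ((p.1⁻¹ * w⁻¹)⁻¹ * w, -(-p.2 + -(q.2 / 2)) + q.2 / 2)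
    refine Prod.ext ?_ (by dsimp only; ring)
    rw [mul_inv, inv_inv, inv_inv, mul_assoc, hww]
  rw [this, ← commutatorElement_def]
  exact Subgroup.commutator_mem_commutator (Subgroup.mem_top _) (Subgroup.mem_top _)

theorem fixesEnds_annulusTranslate (q : Circle × ℝ) : FixesEnds (annulusTranslate q) :=
  ⟨tendsto_comap_iff.2 (tendsto_atTop_add_const_right _ q.2 tendsto_comap),
    tendsto_comap_iff.2 (tendsto_atBot_add_const_right _ q.2 tendsto_comap)⟩

theorem degreeOne_annulusTranslate (q : Circle × ℝ) : DegreeOne (annulusTranslate q) :=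
  ⟨fun _ => Complex.arg q.1, continuous_const, fun p => by rw [Circle.exp_arg]; rfl⟩

/-- A homeomorphism of degree one fixing the ends is in the commutator subgroup. -/
theorem FixesEnds.mem_commutator {h : (Circle × ℝ) ≃ₜ (Circle × ℝ)} (hh : FixesEnds h)
    (hd : DegreeOne h) : h ∈ commutator ((Circle × ℝ) ≃ₜ (Circle × ℝ)) := by
  set τ := annulusTranslate (h (1, 0)) with hτ
  have h1 : τ⁻¹ * h ∈ commutator ((Circle × ℝ) ≃ₜ (Circle × ℝ)) := by
    refine ((fixesEnds_annulusTranslate _).inv.mul hh).mem_commutator_of_fixed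
      ((degreeOne_annulusTranslate _).inv.mul hd) ?_
    change τ.symm (h (1, 0)) = (1, 0)
    rw [Homeomorph.symm_apply_eq]
    exact Prod.ext (one_mul _).symm (zero_add _).symm
  have := mul_mem (annulusTranslate_mem_commutator (h (1, 0))) h1
  rwa [mul_inv_cancel_left] at this

theorem circle_exp_int_mul (n : ℤ) (x : ℝ) : Circle.exp (n * x) = Circle.exp x ^ n :=
  Circle.ext (by rw [Circle.coe_exp, Circle.coe_zpow, Circle.coe_exp, ← Complex.exp_int_mul]
                 push_cast
                 ring_nf)

/-- The continuous map `F` from the annulus to the circle is homotopic to the `n`-th power map. -/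
def HasDegree (F : Circle × ℝ → Circle) (n : ℤ) : Prop :=
  ∃ u : Circle × ℝ → ℝ, Continuous u ∧ ∀ p, F p = p.1 ^ n * Circle.exp (u p)

theorem HasDegree.unique {F : Circle × ℝ → Circle} {n m : ℤ} (hn : HasDegree F n)
    (hm : HasDegree F m) : n = m := by
  obtain ⟨u, hu, hFu⟩ := hn
  obtain ⟨v, hv, hFv⟩ := hm
  have h : ∀ x : ℝ, Circle.exp (n * x + u (Circle.exp x, 0)) =
      Circle.exp (m * x + v (Circle.exp x, 0)) := fun x => by
    rw [Circle.exp_add, Circle.exp_add, circle_exp_int_mul, circle_exp_int_mul]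
    exact (hFu (Circle.exp x, 0)).symm.trans (hFv (Circle.exp x, 0))
  have h1 := Circle.isCoveringMap_exp.const_of_comp
    (g := fun x : ℝ => n * x + u (Circle.exp x, 0) - (m * x + v (Circle.exp x, 0)))
    (by fun_prop) (fun a b => by
      rw [Circle.exp_sub, Circle.exp_sub, h, h, div_self', div_self']) (2 * Real.pi) 0
  simp only [Circle.exp_two_pi, Circle.exp_zero, mul_zero, zero_add] at h1
  have h2 : ((n : ℝ) - m) * (2 * Real.pi) = 0 := by linarith
  have h3 : (n : ℝ) - m = 0 := (mul_eq_zero.1 h2).resolve_right Real.two_pi_pos.ne'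
  exact_mod_cast sub_eq_zero.1 h3

theorem exists_hasDegree {F : Circle × ℝ → Circle} (hF : Continuous F) : ∃ n, HasDegree F n := by
  obtain ⟨L, ⟨-, hL⟩, -⟩ := Circle.isCoveringMap_exp.existsUnique_continuousMap_lifts
    (⟨fun p : ℝ × ℝ => F (Circle.exp p.1, p.2), by fun_prop⟩ : C(ℝ × ℝ, Circle)) (0, 0)
    (Complex.arg (F (Circle.exp 0, 0))) (Circle.exp_arg _)
  replace hL : ∀ p, Circle.exp (L p) = F (Circle.exp p.1, p.2) := congr_fun hL
  obtain ⟨n, hn⟩ := Circle.exp_eq_exp.1 (show Circle.exp (L (0 + 2 * Real.pi, 0)) =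
    Circle.exp (L (0, 0)) by rw [hL, hL, Circle.exp_add_two_pi])
  have hper : ∀ p : ℝ × ℝ, L (p.1 + 2 * Real.pi, p.2) = L p + n * (2 * Real.pi) := fun p => by
    have := Circle.isCoveringMap_exp.const_of_comp
      (g := fun p : ℝ × ℝ => L (p.1 + 2 * Real.pi, p.2) - L p)
      (by fun_prop) (fun a b => by
        simp only [Circle.exp_sub, hL, Circle.exp_add_two_pi, div_self']) p (0, 0)
    simp only [hn] at this
    linarith
  have hv : ∀ t : ℝ, Function.Periodic (fun x => L (x, t) - n * x) (2 * Real.pi) := fun t x => by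
    have := hper (x, t)
    simp only at this ⊢
    rw [this]
    ring
  have hwd : ∀ p : ℝ × ℝ, L (Complex.arg (Circle.exp p.1), p.2) -
      n * Complex.arg (Circle.exp p.1) = L p - n * p.1 := fun p => by
    obtain ⟨m, hm⟩ := Circle.exp_eq_exp.1 (Circle.exp_arg (Circle.exp p.1))
    rw [hm]
    exact (hv p.2).int_mul m p.1
  have hq : IsOpenQuotientMap (Prod.map Circle.exp id : ℝ × ℝ → Circle × ℝ) :=
    IsOpenQuotientMap.prodMap ⟨fun z => ⟨_, Circle.exp_arg z⟩, Circle.exp.continuous,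
      Circle.isCoveringMap_exp.isLocalHomeomorph.isOpenMap⟩ IsOpenQuotientMap.id
  refine ⟨n, fun p => L (Complex.arg p.1, p.2) - n * Complex.arg p.1, ?_, fun p => ?_⟩
  · rw [hq.isQuotientMap.continuous_iff]
    exact Continuous.congr (by fun_prop : Continuous fun p : ℝ × ℝ => L p - n * p.1)
      fun p => (hwd p).symm
  · rw [Circle.exp_sub, hL, circle_exp_int_mul, Circle.exp_arg, mul_div_cancel]

/-- The degree of a homeomorphism of the annulus. -/
noncomputable def annulusDegree (h : (Circle × ℝ) ≃ₜ (Circle × ℝ)) : ℤ :=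
  (exists_hasDegree (F := fun p => (h p).1) (by fun_prop)).choose

theorem hasDegree_annulusDegree (h : (Circle × ℝ) ≃ₜ (Circle × ℝ)) :
    HasDegree (fun p => (h p).1) (annulusDegree h) :=
  (exists_hasDegree (F := fun p => (h p).1) (by fun_prop)).choose_spec

theorem annulusDegree_eq {h : (Circle × ℝ) ≃ₜ (Circle × ℝ)} {n : ℤ}
    (hn : HasDegree (fun p => (h p).1) n) : annulusDegree h = n :=
  (hasDegree_annulusDegree h).unique hn

theorem annulusDegree_eq_one {h : (Circle × ℝ) ≃ₜ (Circle × ℝ)} (hh : DegreeOne h) :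
    annulusDegree h = 1 := by
  obtain ⟨u, hu, hhu⟩ := hh
  exact annulusDegree_eq ⟨u, hu, fun p => by rw [zpow_one]; exact hhu p⟩

theorem degreeOne_of_annulusDegree {h : (Circle × ℝ) ≃ₜ (Circle × ℝ)} (hh : annulusDegree h = 1) :
    DegreeOne h := by
  obtain ⟨u, hu, hhu⟩ := hasDegree_annulusDegree h
  exact ⟨u, hu, fun p => (hhu p).trans (by rw [hh, zpow_one])⟩

theorem annulusDegree_mul (g h : (Circle × ℝ) ≃ₜ (Circle × ℝ)) :
    annulusDegree (g * h) = annulusDegree g * annulusDegree h := by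
  obtain ⟨u, hu, hgu⟩ := hasDegree_annulusDegree g
  obtain ⟨v, hv, hhv⟩ := hasDegree_annulusDegree h
  replace hgu : ∀ p, (g p).1 = p.1 ^ annulusDegree g * Circle.exp (u p) := hgu
  replace hhv : ∀ p, (h p).1 = p.1 ^ annulusDegree h * Circle.exp (v p) := hhv
  refine annulusDegree_eq ⟨fun p => annulusDegree g * v p + u (h p), by fun_prop, fun p => ?_⟩
  change (g (h p)).1 = _
  rw [hgu, hhv, mul_zpow, ← zpow_mul, Circle.exp_add, circle_exp_int_mul, mul_assoc, mul_comm
    (annulusDegree g)]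

/-- The action of homeomorphisms on the fundamental group of the annulus. -/
noncomputable def annulusDegreeHom : ((Circle × ℝ) ≃ₜ (Circle × ℝ)) →* ℤˣ :=
  MonoidHom.toHomUnits
    { toFun := annulusDegree
      map_one' := annulusDegree_eq_one ⟨0, continuous_const, fun p => by
        rw [Pi.zero_apply, Circle.exp_zero, mul_one]
        rfl⟩
      map_mul' := annulusDegree_mul }

open Classical in
/-- The action of homeomorphisms on the ends of the annulus. -/
noncomputable def annulusEndsHom : ((Circle × ℝ) ≃ₜ (Circle × ℝ)) →* ℤˣ where
  toFun h := if FixesEnds h then 1 else -1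
  map_one' := if_pos fixesEnds_one
  map_mul' g h := by
    have hF {k : (Circle × ℝ) ≃ₜ (Circle × ℝ)} (hk : SwapsEnds k) : ¬ FixesEnds k :=
      fun h => h.not_swapsEnds hk
    rcases fixesEnds_or_swapsEnds g with hg | hg <;> rcases fixesEnds_or_swapsEnds h with hh | hh
    · rw [if_pos hg, if_pos hh, if_pos (hg.mul hh), one_mul]
    · rw [if_pos hg, if_neg (hF hh), if_neg (hF (hg.mul_swapsEnds hh)), one_mul]
    · rw [if_neg (hF hg), if_pos hh, if_neg (hF (hg.mul_fixesEnds hh)), mul_one]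
    · rw [if_neg (hF hg), if_neg (hF hh), if_pos (hg.mul hh), neg_mul_neg, one_mul]

theorem annulusEndsHom_of_fixesEnds {h : (Circle × ℝ) ≃ₜ (Circle × ℝ)} (hh : FixesEnds h) :
    annulusEndsHom h = 1 := if_pos hh

theorem annulusEndsHom_of_swapsEnds {h : (Circle × ℝ) ≃ₜ (Circle × ℝ)} (hh : SwapsEnds h) :
    annulusEndsHom h = -1 := if_neg fun h => h.not_swapsEnds hh

theorem fixesEnds_of_annulusEndsHom {h : (Circle × ℝ) ≃ₜ (Circle × ℝ)}
    (hh : annulusEndsHom h = 1) : FixesEnds h := by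
  refine (fixesEnds_or_swapsEnds h).resolve_right fun hs => ?_
  rw [annulusEndsHom_of_swapsEnds hs] at hh
  exact absurd hh (by decide)

theorem surjective_annulusEndsHom_prod_degreeHom :
    Function.Surjective (annulusEndsHom.prod annulusDegreeHom) := by
  have h1 : annulusEndsHom.prod annulusDegreeHom circleInv = (1, -1) :=
    Prod.ext (annulusEndsHom_of_fixesEnds fixesEnds_circleInv) <| Units.ext <|
      annulusDegree_eq ⟨0, continuous_const, fun p => by
        simp [circleInv_apply]⟩
  have h2 : annulusEndsHom.prod annulusDegreeHom heightNeg = (-1, 1) :=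
    Prod.ext (annulusEndsHom_of_swapsEnds ⟨tendsto_heightNeg_upperEnd, tendsto_heightNeg_lowerEnd⟩)
      <| Units.ext <| annulusDegree_eq_one (degreeOne_heightHomeo _)
  rintro ⟨a, b⟩
  rcases Int.units_eq_one_or a with rfl | rfl <;> rcases Int.units_eq_one_or b with rfl | rfl
  · exact ⟨1, map_one _⟩
  · exact ⟨_, h1⟩
  · exact ⟨_, h2⟩
  · exact ⟨circleInv * heightNeg, by rw [map_mul, h1, h2, Prod.mk_mul_mk, one_mul, mul_one]⟩

theorem commutator_eq_ker : commutator ((Circle × ℝ) ≃ₜ (Circle × ℝ)) =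
    (annulusEndsHom.prod annulusDegreeHom).ker := by
  refine le_antisymm (Abelianization.commutator_subset_ker _) fun h hh => ?_
  obtain ⟨h1, h2⟩ := Prod.ext_iff.1 (MonoidHom.mem_ker.1 hh)
  exact (fixesEnds_of_annulusEndsHom h1).mem_commutator
    (degreeOne_of_annulusDegree (congrArg Units.val h2))

/-- The commutator subgroup of `Homeo(S¹ × ℝ)` has index `4`, and the square of
every homeomorphism of `S¹ × ℝ` lies in the commutator subgroup; hence the
abelianization is isomorphic to `ℤ/2ℤ × ℤ/2ℤ`. -/
theorem commutator_homeo_annulus_index_eq_four_and_sq_mem :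
    (commutator ((Circle × ℝ) ≃ₜ (Circle × ℝ))).index = 4 ∧
    ∀ g : (Circle × ℝ) ≃ₜ (Circle × ℝ), g ^ 2 ∈ commutator ((Circle × ℝ) ≃ₜ (Circle × ℝ)) := by
  rw [commutator_eq_ker]
  refine ⟨?_, fun g => ?_⟩
  · rw [Subgroup.index_ker, MonoidHom.range_eq_top.2 surjective_annulusEndsHom_prod_degreeHom,
      Subgroup.card_top, Nat.card_prod, Nat.card_eq_fintype_card, Fintype.card_units_int]
  · rw [MonoidHom.mem_ker, map_pow]
    exact Prod.ext (Int.units_sq _) (Int.units_sq _)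
end

section
/- Let X be a topological space and let h, σ be self-homeomorphisms of X. Suppose the family (σⁿ(supp(h)))_{n≥0} of forward iterates of the support of h is locally finite and pairwise disjoint. Then there exists a self-homeomorphism φ of X such that h = φ ∘ σ ∘ φ⁻¹ ∘ σ⁻¹; in particular, h is a commutator in the group of self-homeomorphisms of X. -/
open Pointwise

/-- The support of a self-homeomorphism: the closure of the set of non-fixed points. -/
def homeoSupp {X : Type*} [TopologicalSpace X] (f : X ≃ₜ X) : Set X :=
  closure {x | f x ≠ x}

section LocallyFiniteGluing

variable {ι X : Type*}

open Classical in
/-- The map that agrees with `g i` on `S i` and is the identity off `⋃ i, S i`. It is meaningful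
when the sets `S i` are pairwise disjoint. -/
noncomputable def piecewiseOn (S : ι → Set X) (g : ι → X → X) (x : X) : X :=
  if hx : ∃ i, x ∈ S i then g hx.choose x else x

variable {S : ι → Set X} {g : ι → X → X} {x : X}

theorem piecewiseOn_of_forall_notMem (hx : ∀ i, x ∉ S i) : piecewiseOn S g x = x :=
  dif_neg (not_exists.2 hx)

theorem eq_of_mem_of_pairwise_disjoint (hS : Pairwise fun i j => Disjoint (S i) (S j)) {i j : ι}
    (hi : x ∈ S i) (hj : x ∈ S j) : i = j :=
  hS.eq fun hij => Set.disjoint_left.1 hij hi hj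

theorem piecewiseOn_of_mem (hS : Pairwise fun i j => Disjoint (S i) (S j)) {i : ι}
    (hx : x ∈ S i) : piecewiseOn S g x = g i x := by
  have hex : ∃ i, x ∈ S i := ⟨i, hx⟩
  rw [piecewiseOn, dif_pos hex, eq_of_mem_of_pairwise_disjoint hS hex.choose_spec hx]

theorem piecewiseOn_leftInverse (hS : Pairwise fun i j => Disjoint (S i) (S j))
    {g' : ι → X → X} (hmaps : ∀ i, Set.MapsTo (g i) (S i) (S i))
    (hinv : ∀ i, Function.LeftInverse (g' i) (g i)) :
    Function.LeftInverse (piecewiseOn S g') (piecewiseOn S g) := by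
  intro x
  by_cases hx : ∃ i, x ∈ S i
  · obtain ⟨i, hi⟩ := hx
    rw [piecewiseOn_of_mem hS hi, piecewiseOn_of_mem hS (hmaps i hi), hinv i x]
  · have hx' := not_exists.1 hx
    rw [piecewiseOn_of_forall_notMem hx', piecewiseOn_of_forall_notMem hx']

theorem mapsTo_of_fixed_off {s : Set X} {f : X → X} (hf : Function.Injective f)
    (hfix : ∀ x ∉ s, f x = x) : Set.MapsTo f s s := by
  intro x hx
  by_contra hfx
  exact hfx ((hf (hfix _ hfx)).symm ▸ hx)

variable [TopologicalSpace X]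

theorem continuous_piecewiseOn (hS : Pairwise fun i j => Disjoint (S i) (S j))
    (hlf : LocallyFinite S) (hc : ∀ i, IsClosed (S i)) (hg : ∀ i, Continuous (g i))
    (hfix : ∀ i, ∀ x ∉ S i, g i x = x) : Continuous (piecewiseOn S g) := by
  refine continuous_iff_continuousAt.2 fun x => ?_
  have hnhds := hlf.iInter_compl_mem_nhds hc x
  by_cases hx : ∃ i, x ∈ S i
  · obtain ⟨i, hi⟩ := hx
    refine (hg i).continuousAt.congr ?_
    filter_upwards [hnhds] with y hy
    simp only [Set.mem_iInter, Set.mem_compl_iff] at hy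
    by_cases hyi : y ∈ S i
    · exact (piecewiseOn_of_mem hS hyi).symm
    · rw [hfix i y hyi, piecewiseOn_of_forall_notMem]
      intro j hyj
      refine hy j (fun hxj => hyi ?_) hyj
      rwa [eq_of_mem_of_pairwise_disjoint hS hi hxj]
  · refine continuousAt_id.congr ?_
    filter_upwards [hnhds] with y hy
    simp only [Set.mem_iInter, Set.mem_compl_iff] at hy
    exact (piecewiseOn_of_forall_notMem fun j => hy j fun hxj => hx ⟨j, hxj⟩).symm

/-- The product of a family of homeomorphisms supported in a locally finite, pairwise disjoint
family of closed sets. -/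
noncomputable def Homeomorph.piecewiseOn (g : ι → X ≃ₜ X)
    (hS : Pairwise fun i j => Disjoint (S i) (S j)) (hlf : LocallyFinite S)
    (hc : ∀ i, IsClosed (S i)) (hfix : ∀ i, ∀ x ∉ S i, g i x = x) : X ≃ₜ X :=
  have hfix' : ∀ i, ∀ x ∉ S i, (g i).symm x = x := fun i x hx =>
    (g i).symm_apply_eq.2 (hfix i x hx).symm
  { toFun := _root_.piecewiseOn S fun i => g i
    invFun := _root_.piecewiseOn S fun i => (g i).symm
    left_inv := piecewiseOn_leftInverse hS
      (fun i => mapsTo_of_fixed_off (g i).injective (hfix i)) fun i => (g i).symm_apply_apply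
    right_inv := piecewiseOn_leftInverse hS
      (fun i => mapsTo_of_fixed_off (g i).symm.injective (hfix' i)) fun i => (g i).apply_symm_apply
    continuous_toFun := continuous_piecewiseOn hS hlf hc (fun i => (g i).continuous) hfix
    continuous_invFun := continuous_piecewiseOn hS hlf hc (fun i => (g i).symm.continuous) hfix' }

end LocallyFiniteGluing

theorem apply_eq_of_notMem_homeoSupp {X : Type*} [TopologicalSpace X] {f : X ≃ₜ X} {x : X}
    (hx : x ∉ homeoSupp f) : f x = x :=
  not_not.1 fun hne => hx (subset_closure hne)

/-- The commutator trick: if the forward iterates of the support of `h` under `σ` form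
a locally finite, pairwise disjoint family, then `h` is the commutator `φ σ φ⁻¹ σ⁻¹`
for some homeomorphism `φ`. -/
theorem isCommutator_of_locallyFinite_disjoint_iterates
    {X : Type*} [TopologicalSpace X] (h σ : X ≃ₜ X)
    (hlf : LocallyFinite fun n : ℕ => ⇑(σ ^ n) '' homeoSupp h)
    (hdisj : Pairwise fun m n : ℕ =>
      Disjoint (⇑(σ ^ m) '' homeoSupp h) (⇑(σ ^ n) '' homeoSupp h)) :
    ∃ φ : X ≃ₜ X, h = φ * σ * φ⁻¹ * σ⁻¹ := by
  set S : ℕ → Set X := fun n => ⇑(σ ^ n) '' homeoSupp h with hSdef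
  have hS0 {x : X} (hx : x ∈ homeoSupp h) : x ∈ S 0 := ⟨x, hx, rfl⟩
  have hSsucc (n : ℕ) (x : X) : σ x ∈ S (n + 1) ↔ x ∈ S n := by
    have hpow : ⇑(σ ^ (n + 1)) = σ ∘ ⇑(σ ^ n) := by rw [pow_succ']; rfl
    simp only [hSdef, hpow, Set.image_comp]
    exact σ.injective.mem_set_image
  have hc (n : ℕ) : IsClosed (S n) := (σ ^ n).isClosedMap _ isClosed_closure
  let g (n : ℕ) : X ≃ₜ X := σ ^ n * h * (σ ^ n)⁻¹
  have hg0 (x : X) : g 0 x = h x := rfl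
  have hgsucc (n : ℕ) (x : X) : g (n + 1) (σ x) = σ (g n x) := by
    have hconj : g (n + 1) * σ = σ * g n := by simp only [g, pow_succ']; group
    exact DFunLike.congr_fun hconj x
  have hfix (n : ℕ) (x : X) (hx : x ∉ S n) : g n x = x := by
    have hsupp : (σ ^ n).symm x ∉ homeoSupp h := fun hmem =>
      hx ⟨_, hmem, (σ ^ n).apply_symm_apply x⟩
    change (σ ^ n) (h ((σ ^ n).symm x)) = x
    rw [apply_eq_of_notMem_homeoSupp hsupp, Homeomorph.apply_symm_apply]
  let φ : X ≃ₜ X := Homeomorph.piecewiseOn g hdisj hlf hc hfix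
  have hφ {n : ℕ} {x : X} (hx : x ∈ S n) : φ x = g n x :=
    piecewiseOn_of_mem (g := fun n => g n) hdisj hx
  have hφ' {x : X} (hx : ∀ n, x ∉ S n) : φ x = x :=
    piecewiseOn_of_forall_notMem (g := fun n => g n) hx
  refine ⟨φ, ?_⟩
  rw [eq_mul_inv_iff_mul_eq, eq_mul_inv_iff_mul_eq]
  refine Homeomorph.ext fun x => ?_
  change h (σ (φ x)) = φ (σ x)
  by_cases hx : ∃ n, x ∈ S n
  · obtain ⟨n, hn⟩ := hx
    have hmem : σ (g n x) ∈ S (n + 1) :=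
      (hSsucc n _).2 (mapsTo_of_fixed_off (g n).injective (hfix n) hn)
    rw [hφ hn, hφ ((hSsucc n x).2 hn), hgsucc]
    refine apply_eq_of_notMem_homeoSupp fun h0 => ?_
    exact n.succ_ne_zero (eq_of_mem_of_pairwise_disjoint hdisj hmem (hS0 h0))
  · have hx' := not_exists.1 hx
    rw [hφ' hx']
    by_cases h0 : σ x ∈ S 0
    · rw [hφ h0, hg0]
    · rw [apply_eq_of_notMem_homeoSupp (fun hmem => h0 (hS0 hmem)), hφ']
      rintro (_ | n)
      · exact h0
      · exact fun hn => hx' n ((hSsucc n x).1 hn)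
end

section
/- Let G be a group and H a subgroup of G of finite index. If H is strongly distorted, then G is strongly distorted. -/
open Pointwise

/-- A group `G` is *strongly distorted* if there exist `m : ℕ` and a sequence
`w : ℕ → ℕ` such that for every sequence `g : ℕ → G` there is a subset `S` of `G`
of cardinality `m` with `g n ∈ S ^ (w n)` for every `n`. -/
def StronglyDistorted (G : Type*) [Group G] : Prop :=
  ∃ (m : ℕ) (w : ℕ → ℕ), ∀ g : ℕ → G, ∃ S : Set G,
    S.Finite ∧ S.ncard = m ∧ ∀ n, g n ∈ S ^ w n

/-- A finite group is strongly distorted. -/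
theorem StronglyDistorted.of_finite (G : Type*) [Group G] [Finite G] : StronglyDistorted G :=
  ⟨Nat.card G, fun _ => 1, fun g =>
    ⟨Set.univ, Set.finite_univ, Set.ncard_univ G, fun n => by simp⟩⟩

/-- In an infinite group, a uniform bound on the cardinality of the sets `S` suffices for
strong distortion. -/
theorem StronglyDistorted.of_ncard_le {G : Type*} [Group G] [Infinite G] (m : ℕ) (w : ℕ → ℕ)
    (h : ∀ g : ℕ → G, ∃ S : Set G, S.Finite ∧ S.ncard ≤ m ∧ ∀ n, g n ∈ S ^ w n) :
    StronglyDistorted G := by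
  refine ⟨m, w, fun g => ?_⟩
  obtain ⟨S, hfin, hcard, hS⟩ := h g
  lift S to Finset G using hfin
  rw [Set.ncard_coe_finset] at hcard
  obtain ⟨U, hSU, hU⟩ := Infinite.exists_superset_card_eq S m hcard
  exact ⟨U, U.finite_toSet, by rw [Set.ncard_coe_finset, hU],
    fun n => Set.pow_subset_pow_left (Finset.coe_subset.2 hSU) (hS n)⟩

/-- Strong distortion is inherited by finite extensions: if a finite-index subgroup
`H` of `G` is strongly distorted, then so is `G`. -/
theorem stronglyDistorted_of_finiteIndex_subgroup {G : Type*} [Group G]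
    (H : Subgroup G) (hfi : H.FiniteIndex) (hH : StronglyDistorted H) :
    StronglyDistorted G := by
  rcases finite_or_infinite G with _ | _
  · exact StronglyDistorted.of_finite G
  obtain ⟨m, w, hw⟩ := hH
  let T : Set G := Set.range fun x : G ⧸ H => x.out
  have hT : T.Finite := Set.finite_range _
  refine StronglyDistorted.of_ncard_le (T.ncard + m) (fun n => w n + 1) fun g => ?_
  let t : ℕ → G := fun n => (g n : G ⧸ H).out
  have ht : ∀ n, (t n)⁻¹ * g n ∈ H := fun n =>
    QuotientGroup.eq.1 (QuotientGroup.out_eq' (g n : G ⧸ H))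
  obtain ⟨S, hfin, hcard, hS⟩ := hw fun n => ⟨(t n)⁻¹ * g n, ht n⟩
  refine ⟨T ∪ H.subtype '' S, hT.union (hfin.image _), ?_, fun n => ?_⟩
  · exact (Set.ncard_union_le _ _).trans
      (Nat.add_le_add_left ((Set.ncard_image_le hfin).trans hcard.le) _)
  · have hmem : (t n)⁻¹ * g n ∈ (H.subtype '' S) ^ w n := by
      rw [← Set.image_pow]
      exact ⟨_, hS n, rfl⟩
    rw [pow_succ', ← mul_inv_cancel_left (t n) (g n)]
    exact Set.mul_mem_mul (Or.inl ⟨_, rfl⟩)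
      (Set.pow_subset_pow_left Set.subset_union_right hmem)
end

section
/- Let G be a strongly distorted group and let ℓ : G → ℝ be a length function, i.e., ℓ(g) ≥ 0 for all g, ℓ(g⁻¹) = ℓ(g) for all g, and ℓ(gh) ≤ ℓ(g) + ℓ(h) for all g, h. Then ℓ is bounded: there exists C ∈ ℝ such that ℓ(g) ≤ C for all g ∈ G. -/
open Pointwise

/-- A subadditive function bounded by `M` on `S` is at most `k * M + l 1` on `S ^ k`. -/
theorem le_mul_add_of_mem_pow {G : Type*} [Monoid G] {l : G → ℝ}
    (hsub : ∀ g h, l (g * h) ≤ l g + l h) {S : Set G} {M : ℝ} (hM : ∀ s ∈ S, l s ≤ M)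
    {k : ℕ} {x : G} (hx : x ∈ S ^ k) : l x ≤ k * M + l 1 := by
  induction k generalizing x with
  | zero =>
    rw [pow_zero, Set.mem_one] at hx
    simp [hx]
  | succ k ih =>
    rw [pow_succ] at hx
    obtain ⟨a, ha, b, hb, rfl⟩ := Set.mem_mul.mp hx
    push_cast
    linarith [hsub a b, ih ha, hM b hb]

/-- A strongly distorted group is strongly bounded: every length function on it is
bounded. -/
theorem lengthFunction_bounded_of_stronglyDistorted {G : Type*} [Group G]
    (hG : StronglyDistorted G) (l : G → ℝ)
    (hnonneg : ∀ g, 0 ≤ l g) (hinv : ∀ g, l g⁻¹ = l g)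
    (hsub : ∀ g h, l (g * h) ≤ l g + l h) :
    ∃ C : ℝ, ∀ g, l g ≤ C := by
  obtain ⟨m, w, h⟩ := hG
  by_contra! hunb
  choose g hg using fun n : ℕ => hunb (w n * n + l 1)
  obtain ⟨S, hfin, -, hS⟩ := h g
  obtain ⟨M, hM⟩ := (hfin.image l).bddAbove
  obtain ⟨n, hn⟩ := exists_nat_ge M
  have hle := le_mul_add_of_mem_pow hsub
    (fun s hs => (hM (Set.mem_image_of_mem l hs)).trans hn) (hS n)
  exact (hg n).not_ge hle
end
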